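/- arXiv:1908.07077 — 2 statements merged into one kernel-verified Lean document; each statement's English description precedes it below -/
import Mathlib

section
/- Let X be a real Hilbert space, let A : X → 2^X be maximally monotone, let B : X → X be monotone and β-Lipschitzian with β > 0, let α, χ > 0, and let ε ∈ (0, α/(β+1)). For every n let W_n : X → X be α-strongly monotone and χ-Lipschitzian, and let γ_n ∈ [ε, (α−ε)/β]. Let x₀ ∈ X, let (λ_n) be a sequence in (0,2) with 0 < inf_n λ_n ≤ sup_n λ_n < 2, let (e_n) be a sequence in X with e_n → 0, let m ≥ 1 be an integer, and let (μ_{n,j})_{n∈ℕ, 0≤j≤n} be a real array such that: μ_{n,j} = 0 whenever n > m and 0 ≤ j ≤ n−m−1; Σ_{j=0}^n μ_{n,j} = 1 for all n; and sup_n max_{0≤j≤n} |μ_{n,j}| < ∞. Define the iteration: x̃_n = e_n + Σ_{j=0}^n μ_{n,j} x_j; v_n* = W_n x̃_n − γ_n B x̃_n; y_n = (W_n + γ_n A)^{-1} v_n*; y_n* = γ_n^{-1}(v_n* − W_n y_n) + B y_n; and x_{n+1} = x_n + λ_n (⟪y_n − x_n, y_n*⟫/‖y_n*‖²) y_n* if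 ⟪y_n − x_n, y_n*⟫ < 0, x_{n+1} = x_n otherwise. If zer(A + B) ≠ ∅, then: (i) Σ_n ‖x_{n+1} − x_n‖² < ∞; (ii) (x_n) converges weakly to a point in zer(A + B), where zer(A+B) = {x : 0 ∈ Ax + Bx}. (In particular each y_n is well defined: W_n + γ_n A has full range and single-valued inverse.) -/
open Filter Topology RealInnerProductSpace

section MonotoneOperators

variable {X : Type*} [NormedAddCommGroup X] [InnerProductSpace ℝ X]

lemma sum_mul_inner_sub_sum_nonneg {ι : Type*} [Fintype ι] (a u : ι → X)
    (hmono : ∀ i j, (0:ℝ) ≤ ⟪a i - a j, u i - u j⟫) (l : ι → ℝ) (hl : ∀ i, 0 ≤ l i)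
    (hl1 : ∑ i, l i = 1) :
    ⟪∑ i, l i • a i, ∑ i, l i • u i⟫ ≤ ∑ i, l i * ⟪a i, u i⟫ := by
  have h : (0:ℝ) ≤ ∑ i, ∑ j, l i * l j * ⟪a i - a j, u i - u j⟫ :=
    Finset.sum_nonneg fun i _ => Finset.sum_nonneg fun j _ =>
      mul_nonneg (mul_nonneg (hl i) (hl j)) (hmono i j)
  have h1 : ∑ i, ∑ j, l i * l j * ⟪a i, u i⟫ = ∑ i, l i * ⟪a i, u i⟫ := by
    refine Finset.sum_congr rfl fun i _ => ?_
    rw [← Finset.sum_mul, ← Finset.mul_sum, hl1, mul_one]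
  have h2 : ∑ i, ∑ j, l i * l j * ⟪a j, u j⟫ = ∑ i, l i * ⟪a i, u i⟫ := by
    rw [Finset.sum_comm, ← h1]
    exact Finset.sum_congr rfl fun i _ => Finset.sum_congr rfl fun j _ => by ring
  have h3 : ∑ i, ∑ j, l i * l j * ⟪a i, u j⟫ = ⟪∑ i, l i • a i, ∑ i, l i • u i⟫ := by
    simp only [sum_inner, inner_sum, real_inner_smul_left, real_inner_smul_right]
    rw [Finset.sum_comm]
    exact Finset.sum_congr rfl fun i _ => Finset.sum_congr rfl fun j _ => by ring
  have h4 : ∑ i, ∑ j, l i * l j * ⟪a j, u i⟫ = ⟪∑ i, l i • a i, ∑ i, l i • u i⟫ := by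
    rw [← h3, Finset.sum_comm]
    exact Finset.sum_congr rfl fun i _ => Finset.sum_congr rfl fun j _ => by ring
  have h5 : ∑ i, ∑ j, l i * l j * ⟪a i - a j, u i - u j⟫
      = ∑ i, ∑ j, l i * l j * ⟪a i, u i⟫ + ∑ i, ∑ j, l i * l j * ⟪a j, u j⟫
        - ∑ i, ∑ j, l i * l j * ⟪a i, u j⟫ - ∑ i, ∑ j, l i * l j * ⟪a j, u i⟫ := by
    simp only [← Finset.sum_add_distrib, ← Finset.sum_sub_distrib]
    refine Finset.sum_congr rfl fun i _ => Finset.sum_congr rfl fun j _ => ?_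
    simp only [inner_sub_left, inner_sub_right]
    ring
  linarith

lemma nonneg_of_forall_add_mul_nonneg {P Q : ℝ} (h : ∀ t ∈ Set.Ioc (0:ℝ) 1, 0 ≤ P + t * Q) :
    0 ≤ P := by
  have hlim : Tendsto (fun t : ℝ => P + t * Q) (𝓝[>] 0) (𝓝 P) := by
    have : Continuous fun t : ℝ => P + t * Q := by fun_prop
    simpa using (this.tendsto 0).mono_left nhdsWithin_le_nhds
  exact ge_of_tendsto hlim (eventually_of_mem (Ioc_mem_nhdsGT one_pos) h)

/-- The Debrunner–Flor extension property for a finite monotone family. -/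
lemma exists_forall_inner_nonpos_of_fintype {ι : Type*} [Fintype ι] (a u : ι → X)
    (hmono : ∀ i j, (0:ℝ) ≤ ⟪a i - a j, u i - u j⟫) :
    ∃ p, ∀ i, ⟪p - a i, p + u i⟫ ≤ 0 := by
  classical
  rcases isEmpty_or_nonempty ι with hι | hι
  · exact ⟨0, fun i => hι.elim i⟩
  set c : ι → X := fun i => u i - a i with hc
  set d : ι → ℝ := fun i => ⟪a i, u i⟫ with hd
  obtain ⟨l, hl, hmin⟩ := (isCompact_stdSimplex ℝ ι).exists_isMinOn
    ⟨_, single_mem_stdSimplex ℝ (Classical.arbitrary ι)⟩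
    (f := fun l : ι → ℝ => 1 / 4 * ‖∑ i, l i • c i‖ ^ 2 + ∑ i, l i * d i)
    (by fun_prop)
  set C := ∑ i, l i • c i with hC
  set D := ∑ i, l i * d i with hD
  have hdual : -(1 / 4) * ‖C‖ ^ 2 - D ≤ 0 := by
    have h1 := sum_mul_inner_sub_sum_nonneg a u hmono l hl.1 hl.2
    have h2 : C = ∑ i, l i • u i - ∑ i, l i • a i := by
      simp [hC, hc, smul_sub]
    set p := ∑ i, l i • a i
    have h3 : ∑ i, l i • u i = C + p := by rw [h2]; abel
    rw [h3, inner_add_right, real_inner_self_eq_norm_sq] at h1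
    have h4 : 0 ≤ ‖p + (1 / 2 : ℝ) • C‖ ^ 2 := by positivity
    rw [norm_add_sq_real, norm_smul, real_inner_smul_right, mul_pow] at h4
    norm_num at h4
    change _ ≤ D at h1
    linarith
  refine ⟨-(1 / 2 : ℝ) • C, fun i => ?_⟩
  have hopt : 0 ≤ 1 / 2 * ⟪C, c i - C⟫ + (d i - D) := by
    refine nonneg_of_forall_add_mul_nonneg (Q := 1 / 4 * ‖c i - C‖ ^ 2) fun t ht => ?_
    have hmem := convex_stdSimplex ℝ ι hl (single_mem_stdSimplex ℝ i)
      (sub_nonneg.2 ht.2) ht.1.le (sub_add_cancel 1 t)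
    have hle := hmin hmem
    have e1 : ∑ j, ((1 - t) • l + t • (Pi.single i 1 : ι → ℝ)) j • c j = C + t • (c i - C) := by
      simp only [Pi.add_apply, Pi.smul_apply, smul_eq_mul, add_smul, Finset.sum_add_distrib,
        mul_smul, ← Finset.smul_sum, Pi.single_apply, ite_smul, one_smul, zero_smul,
        Finset.sum_ite_eq', Finset.mem_univ, if_true]
      rw [← hC]
      module
    have e2 : ∑ j, ((1 - t) • l + t • (Pi.single i 1 : ι → ℝ)) j * d j = D + t * (d i - D) := by
      simp only [Pi.add_apply, Pi.smul_apply, smul_eq_mul, add_mul, Finset.sum_add_distrib,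
        mul_assoc, ← Finset.mul_sum, Pi.single_apply, ite_mul, one_mul, zero_mul,
        Finset.sum_ite_eq', Finset.mem_univ, if_true]
      rw [← hD]
      ring
    change _ ≤ 1 / 4 * ‖_‖ ^ 2 + _ at hle
    rw [e1, e2, norm_add_sq_real, norm_smul, real_inner_smul_right, mul_pow, Real.norm_eq_abs,
      sq_abs] at hle
    have : 0 ≤ t * (1 / 2 * ⟪C, c i - C⟫ + (d i - D) + t * (1 / 4 * ‖c i - C‖ ^ 2)) := by
      linarith
    exact nonneg_of_mul_nonneg_right this ht.1
  have e3 : ⟪-(1 / 2 : ℝ) • C - a i, -(1 / 2 : ℝ) • C + u i⟫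
      = 1 / 4 * ‖C‖ ^ 2 - 1 / 2 * ⟪C, c i⟫ - d i := by
    simp only [hd, hc, inner_sub_left, inner_sub_right, inner_add_right, real_inner_smul_left,
      real_inner_smul_right, real_inner_comm C (a i)]
    rw [real_inner_self_eq_norm_sq]
    ring
  rw [e3]
  rw [inner_sub_right, real_inner_self_eq_norm_sq] at hopt
  linarith

/-- Bounded families in a Hilbert space converge weakly along every ultrafilter. -/
lemma Ultrafilter.exists_tendsto_inner [CompleteSpace X] {ι : Type*} (U : Ultrafilter ι)
    (x : ι → X) (R : ℝ) (hx : ∀ᶠ i in (U : Filter ι), ‖x i‖ ≤ R) :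
    ∃ z, ∀ u, Tendsto (fun i => ⟪x i, u⟫) U (𝓝 ⟪z, u⟫) := by
  have hb : ∀ u, ∀ᶠ i in (U : Filter ι), ⟪x i, u⟫ ∈ Set.Icc (-(R * ‖u‖)) (R * ‖u‖) := fun u => by
    filter_upwards [hx] with i hi
    exact abs_le.1 ((abs_real_inner_le_norm _ _).trans (by gcongr))
  have hex : ∀ u, ∃ L ∈ Set.Icc (-(R * ‖u‖)) (R * ‖u‖), Tendsto (fun i => ⟪x i, u⟫) U (𝓝 L) :=
    fun u => isCompact_Icc.ultrafilter_le_nhds (U.map fun i => ⟪x i, u⟫)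
      (le_principal_iff.2 (hb u))
  choose L hL hlim using hex
  let F : X →ₗ[ℝ] ℝ :=
    { toFun := L
      map_add' := fun u v => tendsto_nhds_unique (hlim (u + v)) <| by
        simpa only [inner_add_right] using (hlim u).add (hlim v)
      map_smul' := fun r u => tendsto_nhds_unique (hlim (r • u)) <| by
        simpa only [real_inner_smul_right, smul_eq_mul, RingHom.id_apply] using
          (hlim u).const_mul r }
  let G : X →L[ℝ] ℝ := F.mkContinuous R fun u => abs_le.2 (hL u)
  refine ⟨(InnerProductSpace.toDual ℝ X).symm G, fun u => ?_⟩
  rw [InnerProductSpace.toDual_symm_apply]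
  exact hlim u

/-- The Debrunner–Flor extension property for a monotone family in a Hilbert space. -/
lemma exists_forall_inner_nonpos [CompleteSpace X] {ι : Type*} (a u : ι → X)
    (hmono : ∀ i j, (0:ℝ) ≤ ⟪a i - a j, u i - u j⟫) :
    ∃ p, ∀ i, ⟪p - a i, p + u i⟫ ≤ 0 := by
  rcases isEmpty_or_nonempty ι with hι | ⟨⟨i₀⟩⟩
  · exact ⟨0, fun i => hι.elim i⟩
  have hfin : ∀ s : Finset ι, ∃ p, ∀ i ∈ s, ⟪p - a i, p + u i⟫ ≤ 0 := fun s => by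
    obtain ⟨p, hp⟩ := exists_forall_inner_nonpos_of_fintype (fun i : s => a i) (fun i : s => u i)
      fun i j => hmono i j
    exact ⟨p, fun i hi => hp ⟨i, hi⟩⟩
  choose q hq using hfin
  have hexp : ∀ (p : X) i, ⟪p - a i, p + u i⟫ = ‖p‖ ^ 2 + ⟪p, u i - a i⟫ - ⟪a i, u i⟫ := by
    intro p i
    simp only [inner_sub_left, inner_sub_right, inner_add_right, real_inner_self_eq_norm_sq,
      real_inner_comm p (a i)]
    ring
  let U : Ultrafilter (Finset ι) := Ultrafilter.of atTop
  have hmem : ∀ i, ∀ᶠ s in (U : Filter (Finset ι)), i ∈ s := fun i => by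
    have : ∀ᶠ s in (atTop : Filter (Finset ι)), i ∈ s := by
      filter_upwards [eventually_ge_atTop {i}] with s hs
      exact hs (Finset.mem_singleton_self i)
    exact Ultrafilter.of_le _ this
  obtain ⟨z, hz⟩ := U.exists_tendsto_inner q (‖u i₀ - a i₀‖ + |⟪a i₀, u i₀⟫| + 1) <| by
    filter_upwards [hmem i₀] with s hs
    have h1 := hq s i₀ hs
    rw [hexp] at h1
    have h2 := (abs_le.1 (abs_real_inner_le_norm (q s) (u i₀ - a i₀))).1
    have h3 := le_abs_self ⟪a i₀, u i₀⟫
    by_contra! hlt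
    nlinarith [norm_nonneg (q s), norm_nonneg (u i₀ - a i₀), abs_nonneg ⟪a i₀, u i₀⟫]
  refine ⟨z, fun i => ?_⟩
  have hlim : Tendsto (fun s => 2 * ⟪q s, z⟫ - ‖z‖ ^ 2 + ⟪q s, u i - a i⟫ - ⟪a i, u i⟫) U
      (𝓝 (2 * ⟪z, z⟫ - ‖z‖ ^ 2 + ⟪z, u i - a i⟫ - ⟪a i, u i⟫)) :=
    ((((hz z).const_mul 2).sub_const _).add (hz _)).sub_const _
  have hle := le_of_tendsto (b := 0) hlim <| by
    filter_upwards [hmem i] with s hs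
    have h1 := hq s i hs
    rw [hexp] at h1
    have h2 : 0 ≤ ‖q s - z‖ ^ 2 := by positivity
    rw [norm_sub_sq_real] at h2
    linarith
  rw [hexp]
  rw [real_inner_self_eq_norm_sq] at hle
  linarith

/-- A set-valued operator is monotone if its graph is. -/
def SetMonotone (A : X → Set X) : Prop :=
  ∀ x y u v, u ∈ A x → v ∈ A y → (0:ℝ) ≤ ⟪x - y, u - v⟫

/-- A monotone operator is maximal if no monotone operator properly extends it. -/
def SetMaximal (A : X → Set X) : Prop :=
  ∀ A' : X → Set X, SetMonotone A' → (∀ x, A x ⊆ A' x) → ∀ x, A' x ⊆ A x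

lemma SetMaximal.mem_of_forall_inner_nonneg {A : X → Set X} (hmax : SetMaximal A)
    (hmono : SetMonotone A) {p v : X} (h : ∀ a, ∀ u ∈ A a, (0:ℝ) ≤ ⟪p - a, v - u⟫) : v ∈ A p := by
  refine hmax (fun x => A x ∪ {w | x = p ∧ w = v}) ?_ (fun x => Set.subset_union_left) p
    (Or.inr ⟨rfl, rfl⟩)
  rintro x y w w' (hw | ⟨rfl, rfl⟩) (hw' | ⟨rfl, rfl⟩)
  · exact hmono x y w w' hw hw'
  · have := h x w hw
    rwa [← neg_sub x, ← neg_sub w, inner_neg_neg] at this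
  · exact h y w' hw'
  · simp

/-- **Minty's theorem**: the resolvent of a maximally monotone operator is defined everywhere. -/
lemma SetMaximal.exists_add_smul_eq [CompleteSpace X] {A : X → Set X} (hmax : SetMaximal A)
    (hmono : SetMonotone A) {γ : ℝ} (hγ : 0 < γ) (w : X) : ∃ p, ∃ u ∈ A p, w = p + γ • u := by
  obtain ⟨p, hp⟩ := exists_forall_inner_nonpos (ι := {q : X × X // q.2 ∈ A q.1})
    (fun q => q.1.1) (fun q => γ • q.1.2 - w) fun i j => by
      rw [sub_sub_sub_cancel_right, ← smul_sub, real_inner_smul_right]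
      exact mul_nonneg hγ.le (hmono _ _ _ _ i.2 j.2)
  refine ⟨p, γ⁻¹ • (w - p), hmax.mem_of_forall_inner_nonneg hmono fun a u hu => ?_, ?_⟩
  · have h := hp ⟨(a, u), hu⟩
    have e : γ⁻¹ • (w - p) - u = -(γ⁻¹ • (p + (γ • u - w))) := by
      rw [smul_add, smul_sub, smul_sub, inv_smul_smul₀ hγ.ne']
      abel
    rw [e, inner_neg_right, real_inner_smul_right]
    have := mul_nonpos_of_nonneg_of_nonpos (inv_pos.2 hγ).le h
    linarith
  · rw [smul_inv_smul₀ hγ.ne']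
    abel

lemma SetMonotone.norm_sub_le_of_add_smul {A : X → Set X} (hmono : SetMonotone A) {γ : ℝ}
    (hγ : 0 ≤ γ) {p q u v : X} (hu : u ∈ A p) (hv : v ∈ A q) :
    ‖p - q‖ ≤ ‖(p + γ • u) - (q + γ • v)‖ := by
  have e : (p + γ • u) - (q + γ • v) = (p - q) + γ • (u - v) := by
    rw [smul_sub]; abel
  have h := mul_nonneg hγ (hmono _ _ _ _ hu hv)
  rw [e]
  refine le_of_sq_le_sq ?_ (norm_nonneg _)
  rw [norm_add_sq_real, real_inner_smul_right]
  nlinarith [sq_nonneg ‖γ • (u - v)‖]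

/-- A maximally monotone operator stays surjective after adding a strongly monotone Lipschitzian
operator. -/
lemma SetMaximal.exists_stronglyMonotone_add_smul_eq [CompleteSpace X] {A : X → Set X}
    (hmax : SetMaximal A) (hmono : SetMonotone A) {T : X → X} {α χ : ℝ} (hα : 0 < α) (hχ : 0 < χ)
    (hTsm : ∀ x y, α * ‖x - y‖ ^ 2 ≤ ⟪x - y, T x - T y⟫)
    (hTlip : ∀ x y, ‖T x - T y‖ ≤ χ * ‖x - y‖) {γ : ℝ} (hγ : 0 < γ) (w : X) :
    ∃ p, ∃ u ∈ A p, w = T p + γ • u := by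
  set s : ℝ := α / (α ^ 2 + χ ^ 2) with hs
  have hs0 : 0 < s := by positivity
  have hsγ : 0 < s * γ := by positivity
  choose J v hvJ hJ using fun x => hmax.exists_add_smul_eq hmono hsγ x
  have hk0 : 0 ≤ 1 - s * α := by
    rw [hs, sub_nonneg, div_mul_eq_mul_div, div_le_one (by positivity)]
    nlinarith
  have hk : s ^ 2 * χ ^ 2 ≤ s * α := by
    have : s * (α ^ 2 + χ ^ 2) = α := by rw [hs]; field_simp
    nlinarith [mul_nonneg hs0.le (mul_nonneg hs0.le (sq_nonneg α))]
  have hstep : ∀ x y, ‖(x - s • (T x - w)) - (y - s • (T y - w))‖ ^ 2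
      ≤ (1 - s * α) * ‖x - y‖ ^ 2 := fun x y => by
    have e : (x - s • (T x - w)) - (y - s • (T y - w)) = (x - y) - s • (T x - T y) := by
      simp only [smul_sub]; abel
    rw [e, norm_sub_sq_real, real_inner_smul_right, norm_smul, mul_pow, Real.norm_eq_abs, sq_abs]
    have h1 := mul_le_mul_of_nonneg_left (hTsm x y) hs0.le
    have h2 : ‖T x - T y‖ ^ 2 ≤ χ ^ 2 * ‖x - y‖ ^ 2 := by
      rw [← mul_pow]; gcongr; exact hTlip x y
    have h3 := mul_le_mul_of_nonneg_left h2 (sq_nonneg s)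
    have h4 := mul_le_mul_of_nonneg_right hk (sq_nonneg ‖x - y‖)
    nlinarith
  have hlip : ∀ x y, dist (J (x - s • (T x - w))) (J (y - s • (T y - w)))
      ≤ √(1 - s * α) * dist x y := fun x y => by
    have h := hmono.norm_sub_le_of_add_smul hsγ.le (hvJ (x - s • (T x - w)))
      (hvJ (y - s • (T y - w)))
    rw [← hJ, ← hJ] at h
    rw [dist_eq_norm, dist_eq_norm]
    refine h.trans (le_of_sq_le_sq ?_ (by positivity))
    rw [mul_pow, Real.sq_sqrt hk0]
    exact hstep x y
  have hcontr : ContractingWith (√(1 - s * α)).toNNReal (fun x => J (x - s • (T x - w))) := by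
    refine ⟨?_, LipschitzWith.of_dist_le' hlip⟩
    rw [Real.toNNReal_lt_one, Real.sqrt_lt' one_pos]
    have : 0 < s * α := by positivity
    linarith
  set p := hcontr.fixedPoint
  have hfix : J (p - s • (T p - w)) = p := hcontr.fixedPoint_isFixedPt
  refine ⟨p, v (p - s • (T p - w)), ?_, ?_⟩
  · have := hvJ (p - s • (T p - w))
    rwa [hfix] at this
  · have h := hJ (p - s • (T p - w))
    rw [hfix, mul_smul] at h
    have h' : s • (w - T p) = s • γ • v (p - s • (T p - w)) := by
      rw [← add_right_inj p, ← h]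
      module
    rw [← smul_right_injective X hs0.ne' h']
    abel

lemma SetMonotone.eq_of_stronglyMonotone_add_smul_eq {A : X → Set X} (hmono : SetMonotone A)
    {T : X → X} {α : ℝ} (hα : 0 < α) (hTsm : ∀ x y, α * ‖x - y‖ ^ 2 ≤ ⟪x - y, T x - T y⟫)
    {γ : ℝ} (hγ : 0 ≤ γ) {p q u v : X} (hu : u ∈ A p) (hv : v ∈ A q)
    (h : T p + γ • u = T q + γ • v) : p = q := by
  have e : T p - T q = -(γ • (u - v)) := by
    rw [smul_sub, neg_sub, sub_eq_sub_iff_add_eq_add, h, add_comm]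
  have h1 := hTsm p q
  rw [e, inner_neg_right, real_inner_smul_right] at h1
  have h2 := mul_nonneg hγ (hmono _ _ _ _ hu hv)
  have h3 : ‖p - q‖ ^ 2 ≤ 0 := by nlinarith
  have h4 : ‖p - q‖ = 0 := by
    have := sq_nonneg ‖p - q‖
    exact pow_eq_zero_iff two_ne_zero |>.1 (le_antisymm h3 this)
  exact sub_eq_zero.1 (norm_eq_zero.1 h4)

/-- The graph of `A + B` is closed under limits that are weak in the first and strong in the second
variable; stated here at the value `0`. -/
lemma SetMaximal.exists_add_eq_zero_of_tendsto [CompleteSpace X] {A : X → Set X}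
    (hmax : SetMaximal A) (hmono : SetMonotone A) {B : X → X} {β : ℝ} (hβ : 0 < β)
    (hBmono : ∀ x y, (0:ℝ) ≤ ⟪x - y, B x - B y⟫)
    (hBlip : ∀ x y, ‖B x - B y‖ ≤ β * ‖x - y‖) {ι : Type*} {l : Filter ι} [l.NeBot]
    {y v : ι → X} {z : X} {R : ℝ} (hmem : ∀ i, v i - B (y i) ∈ A (y i))
    (hv : Tendsto v l (𝓝 0)) (hR : ∀ᶠ i in l, ‖y i‖ ≤ R)
    (hy : ∀ u, Tendsto (fun i => ⟪y i, u⟫) l (𝓝 ⟪z, u⟫)) :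
    ∃ u ∈ A z, u + B z = 0 := by
  have key : ∀ a, ∀ u ∈ A a, (0:ℝ) ≤ ⟪z - a, -(u + B a)⟫ := fun a u hu => by
    have h1 : Tendsto (fun i => (R + ‖a‖) * ‖v i‖) l (𝓝 0) := by
      simpa using hv.norm.const_mul (R + ‖a‖)
    have h2 : Tendsto (fun i => (R + ‖a‖) * ‖v i‖ + (⟪y i, -(u + B a)⟫ - ⟪a, -(u + B a)⟫)) l
        (𝓝 (0 + (⟪z, -(u + B a)⟫ - ⟪a, -(u + B a)⟫))) :=
      h1.add ((hy _).sub_const _)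
    rw [zero_add, ← inner_sub_left] at h2
    refine ge_of_tendsto h2 ?_
    filter_upwards [hR] with i hi
    have h3 := hmono _ _ _ _ (hmem i) hu
    have h4 := hBmono (y i) a
    have h5 : ⟪y i - a, v i⟫ ≤ (R + ‖a‖) * ‖v i‖ :=
      (real_inner_le_norm _ _).trans (by gcongr; exact (norm_sub_le _ _).trans (by gcongr))
    rw [← inner_sub_left]
    have e : ⟪y i - a, v i - B (y i) - u⟫ + ⟪y i - a, B (y i) - B a⟫
        = ⟪y i - a, v i⟫ + ⟪y i - a, -(u + B a)⟫ := by
      rw [← inner_add_right, ← inner_add_right]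
      congr 1
      abel
    linarith
  obtain ⟨p, u, hu, hpu⟩ := hmax.exists_stronglyMonotone_add_smul_eq hmono
    (T := fun x => x + B x) (α := 1) (χ := 1 + β) one_pos (by positivity)
    (fun x y => by
      rw [add_sub_add_comm, inner_add_right, real_inner_self_eq_norm_sq]
      linarith [hBmono x y])
    (fun x y => by
      rw [add_sub_add_comm, add_mul, one_mul]
      exact (norm_add_le _ _).trans (by gcongr; exact hBlip x y)) one_pos z
  have h1 := key p u hu
  have e : u + B p = z - p := by rw [hpu, one_smul]; abel
  rw [e, inner_neg_right, real_inner_self_eq_norm_sq] at h1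
  have h2 : ‖z - p‖ = 0 :=
    pow_eq_zero_iff two_ne_zero |>.1 (le_antisymm (by linarith) (sq_nonneg _))
  have h3 : z = p := sub_eq_zero.1 (norm_eq_zero.1 h2)
  subst h3
  exact ⟨u, hu, by rw [e, sub_self]⟩

/-- **Opial's lemma** for sequences in a Hilbert space, with cluster points along ultrafilters. -/
lemma exists_weak_limit_of_tendsto_norm_sub [CompleteSpace X] {Z : Set X} {x : ℕ → X} {R : ℝ}
    (hR : ∀ n, ‖x n‖ ≤ R) (hconv : ∀ z ∈ Z, ∃ c, Tendsto (fun n => ‖x n - z‖ ^ 2) atTop (𝓝 c))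
    (hclus : ∀ (U : Ultrafilter ℕ) (z : X), (U : Filter ℕ) ≤ atTop →
      (∀ u, Tendsto (fun n => ⟪x n, u⟫) U (𝓝 ⟪z, u⟫)) → z ∈ Z) :
    ∃ z ∈ Z, ∀ u, Tendsto (fun n => ⟪x n, u⟫) atTop (𝓝 ⟪z, u⟫) := by
  have hex : ∀ U : Ultrafilter ℕ, ∃ z, ∀ u, Tendsto (fun n => ⟪x n, u⟫) U (𝓝 ⟪z, u⟫) := fun U =>
    U.exists_tendsto_inner x R (Eventually.of_forall hR)
  have huniq : ∀ (U V : Ultrafilter ℕ) (z z' : X), (U : Filter ℕ) ≤ atTop →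
      (V : Filter ℕ) ≤ atTop → (∀ u, Tendsto (fun n => ⟪x n, u⟫) U (𝓝 ⟪z, u⟫)) →
      (∀ u, Tendsto (fun n => ⟪x n, u⟫) V (𝓝 ⟪z', u⟫)) → z = z' := by
    intro U V z z' hU hV hz hz'
    obtain ⟨c, hc⟩ := hconv z (hclus U z hU hz)
    obtain ⟨c', hc'⟩ := hconv z' (hclus V z' hV hz')
    have hlim : Tendsto (fun n => ⟪x n, z - z'⟫) atTop
        (𝓝 (((c' - c) - (‖z'‖ ^ 2 - ‖z‖ ^ 2)) / 2)) := by
      refine (((hc'.sub hc).sub_const (‖z'‖ ^ 2 - ‖z‖ ^ 2)).div_const 2).congr fun n => ?_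
      rw [norm_sub_sq_real, norm_sub_sq_real, inner_sub_right]
      ring
    have h1 := tendsto_nhds_unique (hz (z - z')) (hlim.mono_left hU)
    have h2 := tendsto_nhds_unique (hz' (z - z')) (hlim.mono_left hV)
    have h3 : ⟪z - z', z - z'⟫ = 0 := by rw [inner_sub_left, h1, h2, sub_self]
    exact sub_eq_zero.1 (inner_self_eq_zero.1 h3)
  obtain ⟨z, hz⟩ := hex (Ultrafilter.of atTop)
  refine ⟨z, hclus _ z (Ultrafilter.of_le _) hz, fun u => ?_⟩
  rw [tendsto_iff_ultrafilter]
  intro U hU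
  obtain ⟨z', hz'⟩ := hex U
  rw [huniq _ U z z' (Ultrafilter.of_le _) hU hz hz']
  exact hz' u

lemma norm_add_smul_sub_sq_le {x y z v : X} {c b : ℝ} (hc : 0 < c) (hcb : c ≤ b) (hb : b < 2)
    (hz : (0:ℝ) ≤ ⟪y - z, v⟫) (ht : ⟪y - x, v⟫ < 0) :
    ‖x + ((c * ⟪y - x, v⟫) / ‖v‖ ^ 2) • v - z‖ ^ 2
      ≤ ‖x - z‖ ^ 2 - (2 - b) / 2 * ‖((c * ⟪y - x, v⟫) / ‖v‖ ^ 2) • v‖ ^ 2 := by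
  have hv : v ≠ 0 := by
    rintro rfl
    simp at ht
  have hN : 0 < ‖v‖ ^ 2 := by positivity
  have hq : -⟪y - x, v⟫ ≤ ⟪x - z, v⟫ := by
    have : ⟪y - z, v⟫ = ⟪y - x, v⟫ + ⟪x - z, v⟫ := by
      rw [← inner_add_left, sub_add_sub_cancel]
    linarith
  set t := ⟪y - x, v⟫
  set q := ⟪x - z, v⟫ with hq_def
  set r := c * t / ‖v‖ ^ 2 with hr_def
  have hrN : r * ‖v‖ ^ 2 = c * t := div_mul_cancel₀ _ hN.ne'
  have hr : r ≤ 0 := div_nonpos_of_nonpos_of_nonneg (by nlinarith) hN.le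
  have e : x + r • v - z = (x - z) + r • v := by abel
  rw [e, norm_add_sq_real, real_inner_smul_right, ← hq_def, norm_smul, mul_pow, Real.norm_eq_abs,
    sq_abs]
  have e2 : r ^ 2 * ‖v‖ ^ 2 = c * (r * t) := by rw [pow_two, mul_assoc, hrN]; ring
  rw [e2]
  have hrt : 0 ≤ r * t := mul_nonneg_of_nonpos_of_nonpos hr ht.le
  have h1 : r * q ≤ -(r * t) := by nlinarith
  have h2 : c * (1 + (2 - b) / 2) ≤ 2 := by nlinarith [sq_nonneg (b - 2)]
  nlinarith [mul_le_mul_of_nonneg_right h2 hrt]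

lemma tendsto_sub_shift {E : Type*} [NormedAddCommGroup E] {x : ℕ → E}
    (hx : Tendsto (fun n => x (n + 1) - x n) atTop (𝓝 0)) (i : ℕ) :
    Tendsto (fun n => x (n - i) - x n) atTop (𝓝 0) := by
  have h : Tendsto (fun n => x n - x (n + i)) atTop (𝓝 0) := by
    induction i with
    | zero => simp
    | succ i ih =>
      have := ih.sub (hx.comp (tendsto_add_atTop_nat i))
      rw [sub_zero] at this
      refine this.congr fun n => ?_
      simp only [Function.comp_apply, add_assoc]
      abel
  refine (h.comp (tendsto_sub_atTop_nat i)).congr' ?_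
  filter_upwards [eventually_ge_atTop i] with n hn
  simp [Nat.sub_add_cancel hn]

/-- Affine combinations with bounded memory are asymptotically close to the current iterate. -/
lemma tendsto_sum_smul_sub {x : ℕ → X} (hx : Tendsto (fun n => x (n + 1) - x n) atTop (𝓝 0))
    {m : ℕ} {μ : ℕ → ℕ → ℝ} (hμ0 : ∀ n j, m < n → j + m + 1 ≤ n → μ n j = 0)
    (hμ1 : ∀ n, ∑ j ∈ Finset.range (n + 1), μ n j = 1)
    {c : ℝ} (hμb : ∀ n j, j ≤ n → |μ n j| ≤ c) :
    Tendsto (fun n => ∑ j ∈ Finset.range (n + 1), μ n j • x j - x n) atTop (𝓝 0) := by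
  have hlim : Tendsto (fun n => ∑ i ∈ Finset.range (m + 1), c * ‖x (n - i) - x n‖) atTop
      (𝓝 0) := by
    simpa using tendsto_finsetSum (Finset.range (m + 1)) fun i _ =>
      (tendsto_sub_shift hx i).norm.const_mul c
  refine squeeze_zero_norm' ?_ hlim
  filter_upwards [eventually_ge_atTop m] with n hn
  have e : ∑ j ∈ Finset.range (n + 1), μ n j • x j - x n
      = ∑ i ∈ Finset.range (m + 1), μ n (n - i) • (x (n - i) - x n) := by
    calc _ = ∑ j ∈ Finset.range (n + 1), μ n j • (x j - x n) := by
          simp only [smul_sub, Finset.sum_sub_distrib]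
          rw [← Finset.sum_smul, hμ1, one_smul]
      _ = ∑ i ∈ Finset.range (n + 1), μ n (n - i) • (x (n - i) - x n) := by
          rw [← Finset.sum_range_reflect]
          simp
      _ = _ := by
          refine (Finset.sum_subset (Finset.range_mono (by omega)) fun i hi hi' => ?_).symm
          rw [Finset.mem_range] at hi hi'
          rw [hμ0 n (n - i) (by omega) (by omega), zero_smul]
  rw [e]
  refine (norm_sum_le _ _).trans (Finset.sum_le_sum fun i _ => ?_)
  rw [norm_smul, Real.norm_eq_abs]
  gcongr
  exact hμb n _ (Nat.sub_le _ _)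

end MonotoneOperators

/-- Corollary 5.2 (perturbed forward-backward-forward algorithm with memory). -/
theorem stmt_4
    {X : Type*} [NormedAddCommGroup X] [InnerProductSpace ℝ X] [CompleteSpace X]
    (A : X → Set X)
    (hAmono : ∀ x y u v, u ∈ A x → v ∈ A y → (0:ℝ) ≤ ⟪x - y, u - v⟫)
    (hAmax : ∀ A' : X → Set X,
      (∀ x y u v, u ∈ A' x → v ∈ A' y → (0:ℝ) ≤ ⟪x - y, u - v⟫) →
      (∀ x, A x ⊆ A' x) → ∀ x, A' x ⊆ A x)
    (B : X → X) (β : ℝ) (hβ : 0 < β)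
    (hBmono : ∀ x y, (0:ℝ) ≤ ⟪x - y, B x - B y⟫)
    (hBlip : ∀ x y, ‖B x - B y‖ ≤ β * ‖x - y‖)
    (α χ : ℝ) (hα : 0 < α) (hχ : 0 < χ)
    (ε : ℝ) (hε : ε ∈ Set.Ioo (0:ℝ) (α / (β + 1)))
    (W : ℕ → X → X)
    (hWsm : ∀ n x y, α * ‖x - y‖ ^ 2 ≤ ⟪x - y, W n x - W n y⟫)
    (hWlip : ∀ n x y, ‖W n x - W n y‖ ≤ χ * ‖x - y‖)
    (γ : ℕ → ℝ) (hγ : ∀ n, γ n ∈ Set.Icc ε ((α - ε) / β))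
    (x₀ : X)
    (lam : ℕ → ℝ) (hlam : ∀ n, lam n ∈ Set.Ioo (0:ℝ) 2)
    (hlaminf : ∃ a, 0 < a ∧ ∀ n, a ≤ lam n)
    (hlamsup : ∃ b, b < 2 ∧ ∀ n, lam n ≤ b)
    (e : ℕ → X) (he : Tendsto e atTop (𝓝 (0:X)))
    (m : ℕ) (hm : 1 ≤ m)
    (μ : ℕ → ℕ → ℝ)
    (hμ0 : ∀ n j, m < n → j + m + 1 ≤ n → μ n j = 0)
    (hμ1 : ∀ n, ∑ j ∈ Finset.range (n + 1), μ n j = 1)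
    (hμb : ∃ c, ∀ n j, j ≤ n → |μ n j| ≤ c)
    (xt vstar y ystar x : ℕ → X)
    (hxt : ∀ n, xt n = e n + ∑ j ∈ Finset.range (n + 1), μ n j • x j)
    (hvstar : ∀ n, vstar n = W n (xt n) - γ n • B (xt n))
    (hy : ∀ n, (γ n)⁻¹ • (vstar n - W n (y n)) ∈ A (y n))
    (hystar : ∀ n, ystar n = (γ n)⁻¹ • (vstar n - W n (y n)) + B (y n))
    (hx0 : x 0 = x₀)
    (hxrec : ∀ n, x (n + 1) =
      if ⟪y n - x n, ystar n⟫ < 0 then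
        x n + ((lam n * ⟪y n - x n, ystar n⟫) / ‖ystar n‖ ^ 2) • ystar n
      else x n)
    (hzer : ∃ z, ∃ u ∈ A z, u + B z = 0) :
    (∀ n (w : X), ∃! p, ∃ u ∈ A p, w = W n p + γ n • u) ∧
    Summable (fun n => ‖x (n + 1) - x n‖ ^ 2) ∧
    ∃ z, (∃ u ∈ A z, u + B z = 0) ∧
      ∀ u : X, Tendsto (fun n => ⟪x n, u⟫) atTop (𝓝 ⟪z, u⟫) := by
  obtain ⟨hε0, hε1⟩ := hε
  have hεα : ε < α := by
    rw [lt_div_iff₀ (by positivity)] at hε1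
    nlinarith
  have hαε : 0 < α - ε := sub_pos.2 hεα
  have hγ0 : ∀ n, 0 < γ n := fun n => hε0.trans_le (hγ n).1
  have hmono : SetMonotone A := hAmono
  have hmax : SetMaximal A := hAmax
  obtain ⟨a, ha, hal⟩ := hlaminf
  obtain ⟨b, hb, hlb⟩ := hlamsup
  obtain ⟨c, hc⟩ := hμb
  have hysA : ∀ n, ystar n - B (y n) ∈ A (y n) := fun n => by
    rw [hystar, add_sub_cancel_right]
    exact hy n
  have hnonneg : ∀ z, (∃ u ∈ A z, u + B z = 0) → ∀ n, (0:ℝ) ≤ ⟪y n - z, ystar n⟫ := by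
    rintro z ⟨u, hu, huz⟩ n
    have h1 := hAmono _ _ _ _ (hysA n) hu
    have h2 := hBmono (y n) z
    have e : ystar n = (ystar n - B (y n) - u) + (B (y n) - B z) := by
      rw [← eq_neg_iff_add_eq_zero] at huz
      rw [huz]
      abel
    rw [e, inner_add_right]
    exact add_nonneg h1 h2
  have hfejer : ∀ z, (∃ u ∈ A z, u + B z = 0) → ∀ n,
      ‖x (n + 1) - z‖ ^ 2 ≤ ‖x n - z‖ ^ 2 - (2 - b) / 2 * ‖x (n + 1) - x n‖ ^ 2 := by
    intro z hz n
    rw [hxrec n]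
    split_ifs with h
    · rw [add_sub_cancel_left]
      exact norm_add_smul_sub_sq_le (hlam n).1 (hlb n) hb (hnonneg z hz n) h
    · simp
  have hb2 : 0 < (2 - b) / 2 := by linarith
  have hanti : ∀ z, (∃ u ∈ A z, u + B z = 0) → Antitone fun n => ‖x n - z‖ ^ 2 := fun z hz =>
    antitone_nat_of_succ_le fun n => by
      have := hfejer z hz n
      have : 0 ≤ (2 - b) / 2 * ‖x (n + 1) - x n‖ ^ 2 := by positivity
      linarith
  obtain ⟨z₀, hz₀⟩ := hzer
  have hsum : Summable fun n => ‖x (n + 1) - x n‖ ^ 2 := by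
    have hpart : ∀ n, (2 - b) / 2 * ∑ k ∈ Finset.range n, ‖x (k + 1) - x k‖ ^ 2
        ≤ ‖x 0 - z₀‖ ^ 2 - ‖x n - z₀‖ ^ 2 := fun n => by
      induction n with
      | zero => simp
      | succ n ih =>
        rw [Finset.sum_range_succ, mul_add]
        linarith [hfejer z₀ hz₀ n]
    refine summable_of_sum_range_le (c := ‖x 0 - z₀‖ ^ 2 / ((2 - b) / 2))
      (fun n => by positivity) fun n => ?_
    rw [le_div_iff₀' hb2]
    linarith [hpart n, sq_nonneg ‖x n - z₀‖]
  have hdiff : Tendsto (fun n => x (n + 1) - x n) atTop (𝓝 0) := by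
    rw [tendsto_zero_iff_norm_tendsto_zero]
    simpa using hsum.tendsto_atTop_zero.sqrt
  have hxtx : Tendsto (fun n => xt n - x n) atTop (𝓝 0) := by
    have := he.add (tendsto_sum_smul_sub hdiff hμ0 hμ1 hc)
    rw [add_zero] at this
    refine this.congr fun n => ?_
    rw [hxt]
    abel
  have hystar' : ∀ n, ystar n = (γ n)⁻¹ • (W n (xt n) - W n (y n)) - (B (xt n) - B (y n)) :=
    fun n => by
      rw [hystar, hvstar, sub_right_comm, smul_sub, inv_smul_smul₀ (hγ0 n).ne']
      abel
  set k := ε * (β / (α - ε))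
  set K := ε⁻¹ * χ + β with hK
  have hk0 : 0 < k := by positivity
  have hK0 : 0 < K := by positivity
  have hysnorm : ∀ n, ‖ystar n‖ ≤ K * ‖xt n - y n‖ := fun n => by
    rw [hystar', hK, add_mul, mul_assoc]
    refine (norm_sub_le _ _).trans (add_le_add ?_ (hBlip _ _))
    rw [norm_smul, Real.norm_of_nonneg (inv_pos.2 (hγ0 n)).le]
    exact mul_le_mul (inv_anti₀ hε0 (hγ n).1) (hWlip n _ _) (norm_nonneg _) (by positivity)
  have hysinner : ∀ n, k * ‖xt n - y n‖ ^ 2 ≤ ⟪xt n - y n, ystar n⟫ := fun n => by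
    have h1 := mul_le_mul_of_nonneg_left (hWsm n (xt n) (y n)) (inv_pos.2 (hγ0 n)).le
    have h2 : ⟪xt n - y n, B (xt n) - B (y n)⟫ ≤ β * ‖xt n - y n‖ ^ 2 := by
      refine (real_inner_le_norm _ _).trans ?_
      have := mul_le_mul_of_nonneg_left (hBlip (xt n) (y n)) (norm_nonneg (xt n - y n))
      linarith
    have h3 : k ≤ (γ n)⁻¹ * α - β := by
      have h4 : β / (α - ε) ≤ (γ n)⁻¹ := by
        rw [← inv_div]
        exact inv_anti₀ (hγ0 n) (hγ n).2
      have h5 : γ n * β ≤ α - ε := (le_div_iff₀ hβ).1 (hγ n).2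
      have h6 : (γ n)⁻¹ * (γ n * β) = β := inv_mul_cancel_left₀ (hγ0 n).ne' β
      have h7 := mul_le_mul_of_nonneg_left h5 (inv_pos.2 (hγ0 n)).le
      have h8 := mul_le_mul_of_nonneg_left h4 hε0.le
      linarith
    rw [hystar', inner_sub_right, real_inner_smul_right]
    have h9 := mul_le_mul_of_nonneg_right h3 (sq_nonneg ‖xt n - y n‖)
    linarith
  have hgap : ∀ n, -⟪y n - x n, ystar n⟫ ≤ a⁻¹ * ‖x (n + 1) - x n‖ * ‖ystar n‖ := fun n => by
    by_cases ht : ⟪y n - x n, ystar n⟫ < 0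
    · have hv : 0 < ‖ystar n‖ := by
        rw [norm_pos_iff]
        intro h0
        simp [h0] at ht
      have e : ‖x (n + 1) - x n‖ * ‖ystar n‖ = lam n * -⟪y n - x n, ystar n⟫ := by
        rw [hxrec n, if_pos ht, add_sub_cancel_left, norm_smul, Real.norm_eq_abs, abs_div,
          abs_mul, abs_of_pos (hlam n).1, abs_of_neg ht, abs_of_pos (by positivity)]
        field_simp
      rw [mul_assoc, e, ← div_eq_inv_mul, le_div_iff₀ ha, mul_comm]
      exact mul_le_mul_of_nonneg_right (hal n) (by linarith)
    · have : 0 ≤ a⁻¹ * ‖x (n + 1) - x n‖ * ‖ystar n‖ := by positivity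
      linarith
  have hxty : Tendsto (fun n => xt n - y n) atTop (𝓝 0) := by
    have hlim : Tendsto (fun n => k⁻¹ * (K * (‖xt n - x n‖ + a⁻¹ * ‖x (n + 1) - x n‖))) atTop
        (𝓝 0) := by
      simpa using ((hxtx.norm.add (hdiff.norm.const_mul a⁻¹)).const_mul K).const_mul k⁻¹
    refine squeeze_zero_norm (fun n => ?_) hlim
    rw [← div_eq_inv_mul, le_div_iff₀' hk0]
    rcases (norm_nonneg (xt n - y n)).eq_or_lt with h0 | h0
    · rw [← h0]
      simp only [mul_zero]
      positivity
    have h1 : ⟪xt n - y n, ystar n⟫ = ⟪xt n - x n, ystar n⟫ + -⟪y n - x n, ystar n⟫ := by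
      rw [← inner_neg_left, ← inner_add_left]
      congr 1
      abel
    have h2 := real_inner_le_norm (xt n - x n) (ystar n)
    have h3 : k * ‖xt n - y n‖ ^ 2
        ≤ (‖xt n - x n‖ + a⁻¹ * ‖x (n + 1) - x n‖) * ‖ystar n‖ := by
      linarith [hysinner n, hgap n]
    have h4 := h3.trans (mul_le_mul_of_nonneg_left (hysnorm n)
      (by positivity : 0 ≤ ‖xt n - x n‖ + a⁻¹ * ‖x (n + 1) - x n‖))
    refine le_of_mul_le_mul_right ?_ h0
    linarith
  have hys0 : Tendsto ystar atTop (𝓝 0) :=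
    squeeze_zero_norm hysnorm (by simpa using hxty.norm.const_mul K)
  have hyx : Tendsto (fun n => y n - x n) atTop (𝓝 0) := by
    simpa using hxtx.sub hxty
  have hbound : ∀ n, ‖x n‖ ≤ ‖x 0 - z₀‖ + ‖z₀‖ := fun n => by
    have h1 : ‖x n - z₀‖ ≤ ‖x 0 - z₀‖ :=
      le_of_sq_le_sq (hanti z₀ hz₀ (Nat.zero_le n)) (norm_nonneg _)
    have h2 := norm_add_le (x n - z₀) z₀
    rw [sub_add_cancel] at h2
    linarith
  refine ⟨fun n w => ?_, hsum, ?_⟩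
  · obtain ⟨p, u, hu, hp⟩ := hmax.exists_stronglyMonotone_add_smul_eq hmono hα hχ (hWsm n)
      (hWlip n) (hγ0 n) w
    refine ⟨p, ⟨u, hu, hp⟩, ?_⟩
    rintro q ⟨v, hv, hq⟩
    exact hmono.eq_of_stronglyMonotone_add_smul_eq hα (hWsm n) (hγ0 n).le hv hu (hq.symm.trans hp)
  · refine exists_weak_limit_of_tendsto_norm_sub (Z := {z | ∃ u ∈ A z, u + B z = 0}) hbound
      (fun z hz => ⟨_, tendsto_atTop_ciInf (hanti z hz) ⟨0, ?_⟩⟩) fun U z hU hz => ?_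
    · rintro _ ⟨n, rfl⟩
      positivity
    · refine hmax.exists_add_eq_zero_of_tendsto hmono hβ hBmono hBlip hysA (hys0.mono_left hU)
        (R := ‖x 0 - z₀‖ + ‖z₀‖ + 1) (l := U) ?_ fun u => ?_
      · have h1 : ∀ᶠ n in atTop, ‖y n - x n‖ < 1 :=
          (by simpa using hyx.norm : Tendsto (fun n => ‖y n - x n‖) atTop (𝓝 0)).eventually_lt_const
            one_pos
        filter_upwards [hU h1] with n hn
        have h2 := norm_add_le (y n - x n) (x n)
        rw [sub_add_cancel] at h2
        have hn' : ‖y n - x n‖ < 1 := hn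
        linarith [hbound n]
      · have h1 : Tendsto (fun n => ⟪y n - x n, u⟫) U (𝓝 ⟪(0:X), u⟫) :=
          (hyx.mono_left hU).inner tendsto_const_nhds
        have h2 := h1.add (hz u)
        rw [inner_zero_left, zero_add] at h2
        refine h2.congr fun n => ?_
        rw [← inner_add_left, sub_add_cancel]
end

section
/- Consider finite families of real Hilbert spaces (Y_i)_{i∈I} and (Z_j)_{j∈J}; for each i ∈ I and j ∈ J let A_i : Y_i → 2^{Y_i} and B_j : Z_j → 2^{Z_j} be maximally monotone, let C_i : Y_i → Y_i be monotone and μ_i-Lipschitzian (μ_i > 0), let D_j : Z_j → Z_j be monotone and ν_j-Lipschitzian (ν_j > 0), let L_{ji} : Y_i → Z_j be bounded linear, and let s_i* ∈ Y_i, r_j ∈ Z_j. Let Z be the Kuhn–Tucker set of all ((x_i)_{i∈I},(v_j*)_{j∈J}) with s_i* − Σ_{k∈J} L_{ki}* v_k* ∈ A_i x_i + C_i x_i for all i and Σ_{k∈I} L_{jk} x_k − r_j ∈ (B_j + D_j)^{-1} v_j* for all j, and suppose Z ≠ ∅. For each i, j let α_i, χ_i, β_j, κ_j > 0, ε_i ∈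 (0, α_i/(μ_i+1)), δ_j ∈ (0, β_j/(ν_j+1)), let (F_{i,n})_n be α_i-strongly monotone χ_i-Lipschitzian operators on Y_i, let (W_{j,n})_n be β_j-strongly monotone κ_j-Lipschitzian operators on Z_j, and let γ_{i,n} ∈ [ε_i, (α_i−ε_i)/μ_i], τ_{j,n} ∈ [δ_j, (β_j−δ_j)/ν_j]. Let (λ_n) be a sequence in (0,2) with 0 < inf λ_n ≤ sup λ_n < 2, and let the iterates ((x_{i,n})_i,(y_{j,n})_j,(v_{j,n}*)_j) be generated from initial points by: l_{i,n}* = F_{i,n} x̃_{i,n} − γ_{i,n} C_i x̃_{i,n} − γ_{i,n} Σ_j L_{ji}* ṽ_{j,n}*; a_{i,n} = (F_{i,n} + γ_{i,n} A_i)^{-1}(l_{i,n}* + γ_{i,n} s_i*); o_{i,n}* = γ_{i,n}^{-1}(l_{i,n}* − F_{i,n} a_{i,n}) + C_i a_{i,n}; t_{j,n}* = W_{j,n} ỹ_{j,n} − τ_{j,n} D_j ỹ_{j,n} + τ_{j,n} ṽ_{j,n}*; b_{j,n} = (W_{j,n} + τ_{j,n} B_j)^{-1} t_{j,n}*; f_{j,n}*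 = τ_{j,n}^{-1}(t_{j,n}* − W_{j,n} b_{j,n}) + D_j b_{j,n}; c_{j,n} = Σ_i L_{ji} x̃_{i,n} − ỹ_{j,n} + ṽ_{j,n}* − r_j; a_{i,n}* = o_{i,n}* + Σ_j L_{ji}* c_{j,n}; b_{j,n}* = f_{j,n}* − c_{j,n}; c_{j,n}* = r_j + b_{j,n} − Σ_i L_{ji} a_{i,n}; σ_n = Σ_i ‖a_{i,n}*‖² + Σ_j(‖b_{j,n}*‖² + ‖c_{j,n}*‖²); θ_n = Σ_i ⟪a_{i,n}−x_{i,n}, a_{i,n}*⟫ + Σ_j(⟪b_{j,n}−y_{j,n}, b_{j,n}*⟫ + ⟪c_{j,n}−v_{j,n}*, c_{j,n}*⟫); ρ_n = λ_n θ_n/σ_n if θ_n < 0, ρ_n = 0 otherwise; x_{i,n+1} = x_{i,n} + ρ_n a_{i,n}*, y_{j,n+1} = y_{j,n} + ρ_n b_{j,n}*, v_{j,n+1}* = v_{j,n}* + ρ_n c_{j,n}*. If x̃_{i,n} − x_{i,n} → 0, ỹ_{j,n} − y_{j,n} → 0, and ṽ_{j,n}* − v_{j,n}* → 0 for all i, j,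 then x_n = (x_{i,n})_i converges weakly to some x̄, v_n* = (v_{j,n}*)_j converges weakly to some v̄*, (x̄, v̄*) ∈ Z, x̄ solves the primal system (for all i: s_i* ∈ A_i x_i + Σ_j L_{ji}*((B_j+D_j)(Σ_k L_{jk} x_k − r_j)) + C_i x_i), and v̄* solves the corresponding dual system. -/
open Filter Topology RealInnerProductSpace

section Abstract

/-- A bounded real family has a limit along every ultrafilter. -/
theorem exists_tendsto_ultrafilter_of_abs_le {ι : Type*} (U : Ultrafilter ι) {f : ι → ℝ} {R : ℝ}
    (hf : ∀ n, |f n| ≤ R) : ∃ l : ℝ, Tendsto f U (𝓝 l) := by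
  obtain ⟨l, -, hl⟩ := (isCompact_Icc (a := -R) (b := R)).ultrafilter_le_nhds (U.map f)
    (by
      rw [le_principal_iff]
      exact Filter.mem_map.2 (Filter.mem_of_superset univ_mem fun n _ => abs_le.1 (hf n)))
  exact ⟨l, hl⟩

variable {H : Type*} [NormedAddCommGroup H] [InnerProductSpace ℝ H]

/-- A bounded family in a Hilbert space has a weak limit along every ultrafilter. -/
theorem exists_weak_limit_ultrafilter [CompleteSpace H] {ι : Type*} (U : Ultrafilter ι)
    (p : ι → H) {R : ℝ} (hp : ∀ n, ‖p n‖ ≤ R) :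
    ∃ z : H, ∀ u, Tendsto (fun n => ⟪p n, u⟫) U (𝓝 ⟪z, u⟫) := by
  have hbd : ∀ u n, |⟪p n, u⟫| ≤ R * ‖u‖ := fun u n =>
    (abs_real_inner_le_norm _ _).trans (mul_le_mul_of_nonneg_right (hp n) (norm_nonneg _))
  have hlim : ∀ u, ∃ l : ℝ, Tendsto (fun n => ⟪p n, u⟫) U (𝓝 l) := fun u =>
    exists_tendsto_ultrafilter_of_abs_le U (hbd u)
  choose φ hφ using hlim
  let f : H →ₗ[ℝ] ℝ :=
    { toFun := φ
      map_add' := fun u w => tendsto_nhds_unique (hφ (u + w)) (by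
        simpa only [inner_add_right] using (hφ u).add (hφ w))
      map_smul' := fun t u => tendsto_nhds_unique (hφ (t • u)) (by
        simpa only [inner_smul_right, RingHom.id_apply, smul_eq_mul] using (hφ u).const_mul t) }
  let g : H →L[ℝ] ℝ := f.mkContinuous R fun u =>
    le_of_tendsto (hφ u).abs (Eventually.of_forall (hbd u))
  refine ⟨(InnerProductSpace.toDual ℝ H).symm g, fun u => ?_⟩
  rw [InnerProductSpace.toDual_symm_apply]
  exact hφ u

/-- Inner products of a bounded family with a strongly null family tend to zero. -/
theorem tendsto_inner_of_norm_le {ι : Type*} {l : Filter ι} {p q : ι → H} {R : ℝ}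
    (hp : ∀ n, ‖p n‖ ≤ R) (hq : Tendsto q l (𝓝 0)) :
    Tendsto (fun n => ⟪p n, q n⟫) l (𝓝 0) := by
  refine squeeze_zero_norm (a := fun n => R * ‖q n‖) (fun n => ?_) ?_
  · exact (norm_inner_le_norm _ _).trans (mul_le_mul_of_nonneg_right (hp n) (norm_nonneg _))
  · simpa using hq.norm.const_mul R

/-- Minty's trick for a continuous operator. -/
theorem eq_of_monotone_related {Q : H → H} (hQc : Continuous Q) {z k : H}
    (h : ∀ y, 0 ≤ ⟪z - y, k - Q y⟫) : k = Q z := by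
  have key : ∀ w, 0 ≤ ⟪w, k - Q z⟫ := by
    intro w
    have h1 : ∀ t : ℝ, 0 < t → 0 ≤ ⟪w, k - Q (z - t • w)⟫ := by
      intro t ht
      have := h (z - t • w)
      rw [sub_sub_cancel, inner_smul_left] at this
      exact nonneg_of_mul_nonneg_right this ht
    have h2 : Tendsto (fun t : ℝ => ⟪w, k - Q (z - t • w)⟫) (𝓝[>] 0) (𝓝 ⟪w, k - Q z⟫) := by
      have : Continuous fun t : ℝ => ⟪w, k - Q (z - t • w)⟫ := by fun_prop
      simpa using (this.tendsto 0).mono_left nhdsWithin_le_nhds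
    exact ge_of_tendsto h2 (eventually_mem_nhdsWithin.mono fun t ht => h1 t ht)
  have := key (-(k - Q z))
  rw [inner_neg_left, real_inner_self_eq_norm_sq] at this
  have h0 : ‖k - Q z‖ = 0 := by nlinarith [norm_nonneg (k - Q z)]
  exact sub_eq_zero.1 (norm_eq_zero.1 h0)

/-- Weak-strong closedness of the graph of `T + Q` at zero, with `T` maximally monotone and `Q`
monotone and Lipschitzian. -/
theorem neg_mem_of_weak_limit [CompleteSpace H] {T : H → Set H}
    (hTmono : ∀ x y u v, u ∈ T x → v ∈ T y → (0 : ℝ) ≤ ⟪x - y, u - v⟫)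
    (hTmax : ∀ x u, (∀ y v, v ∈ T y → (0 : ℝ) ≤ ⟪x - y, u - v⟫) → u ∈ T x)
    {Q : H → H} {K : ℝ} (hQmono : ∀ x y, (0 : ℝ) ≤ ⟪x - y, Q x - Q y⟫)
    (hQlip : ∀ x y, ‖Q x - Q y‖ ≤ K * ‖x - y‖) {ι : Type*} (U : Ultrafilter ι)
    {m ms : ι → H} {R : ℝ} (hm : ∀ n, ‖m n‖ ≤ R) (hms : Tendsto ms U (𝓝 0))
    (hmem : ∀ n, ms n - Q (m n) ∈ T (m n)) {z : H}
    (hz : ∀ u, Tendsto (fun n => ⟪m n, u⟫) U (𝓝 ⟪z, u⟫)) : -Q z ∈ T z := by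
  have hQc : Continuous Q :=
    (LipschitzWith.of_dist_le_mul (K := K.toNNReal) fun x y => by
      rw [dist_eq_norm, dist_eq_norm]
      exact (hQlip x y).trans
        (mul_le_mul_of_nonneg_right (Real.le_coe_toNNReal K) (norm_nonneg _))).continuous
  have hQb : ∀ n, ‖Q (m n)‖ ≤ |K| * R + ‖Q 0‖ := by
    intro n
    have h1 := hQlip (m n) 0
    rw [sub_zero] at h1
    have h2 : K * ‖m n‖ ≤ |K| * R :=
      (mul_le_mul_of_nonneg_right (le_abs_self K) (norm_nonneg _)).trans
        (mul_le_mul_of_nonneg_left (hm n) (abs_nonneg K))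
    have h3 := norm_le_norm_sub_add (Q (m n)) (Q 0)
    linarith
  obtain ⟨k, hk⟩ := exists_weak_limit_ultrafilter U (fun n => Q (m n)) hQb
  obtain ⟨l, hl⟩ := exists_tendsto_ultrafilter_of_abs_le U (f := fun n => ⟪m n, Q (m n)⟫)
    fun n => (abs_real_inner_le_norm _ _).trans
      (mul_le_mul (hm n) (hQb n) (norm_nonneg _) ((norm_nonneg _).trans (hm n)))
  have hms0 : Tendsto (fun n => ⟪m n, ms n⟫) U (𝓝 0) := tendsto_inner_of_norm_le hm hms
  have hmsw : ∀ y, Tendsto (fun n => ⟪y, ms n⟫) U (𝓝 0) := fun y =>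
    tendsto_inner_of_norm_le (R := ‖y‖) (fun _ => le_rfl) hms
  have hQy : ∀ y, Tendsto (fun n => ⟪m n - y, Q (m n) - Q y⟫) U
      (𝓝 (l - ⟪z, Q y⟫ - (⟪k, y⟫ - ⟪y, Q y⟫))) := by
    intro y
    refine ((hl.sub (hz (Q y))).sub ((hk y).sub_const ⟪y, Q y⟫)).congr fun n => ?_
    simp only [inner_sub_left, inner_sub_right, real_inner_comm y (Q (m n))]
    ring
  have hT : ∀ y w, Tendsto (fun n => ⟪m n - y, ms n - Q (m n) - w⟫) U
      (𝓝 (0 - l - ⟪z, w⟫ - (0 - ⟪k, y⟫ - ⟪y, w⟫))) := by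
    intro y w
    refine (((hms0.sub hl).sub (hz w)).sub
      (((hmsw y).sub (hk y)).sub_const ⟪y, w⟫)).congr fun n => ?_
    simp only [inner_sub_left, inner_sub_right, real_inner_comm y (Q (m n))]
    ring
  have hl1 : ⟪z, k⟫ ≤ l := by
    have := ge_of_tendsto' (hQy z) fun n => hQmono _ _
    rw [real_inner_comm k z]
    linarith
  have hkT : -k ∈ T z := by
    refine hTmax z (-k) fun y w hw => ?_
    have := ge_of_tendsto' (hT y w) fun n => hTmono _ _ _ _ (hmem n) hw
    simp only [inner_sub_left, inner_sub_right, inner_neg_right, real_inner_comm k y]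
    linarith [real_inner_comm k y]
  have hl2 : l ≤ ⟪z, k⟫ := by
    have := ge_of_tendsto' (hT z (-k)) fun n => hTmono _ _ _ _ (hmem n) hkT
    simp only [inner_neg_right] at this
    linarith [real_inner_comm k z]
  have hkz : k = Q z := by
    refine eq_of_monotone_related hQc fun y => ?_
    have := ge_of_tendsto' (hQy y) fun n => hQmono _ _
    simp only [inner_sub_left, inner_sub_right]
    linarith [real_inner_comm k y]
  rwa [← hkz]

/-- Opial's lemma, formulated with ultrafilters. -/
theorem exists_weak_limit_of_opial [CompleteSpace H] {p : ℕ → H} {S : Set H}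
    (hne : S.Nonempty) (hanti : ∀ z ∈ S, Antitone fun n => ‖p n - z‖)
    (hcluster : ∀ (U : Ultrafilter ℕ) (z : H), (U : Filter ℕ) ≤ atTop →
      (∀ u, Tendsto (fun n => ⟪p n, u⟫) U (𝓝 ⟪z, u⟫)) → z ∈ S) :
    ∃ z ∈ S, ∀ u, Tendsto (fun n => ⟪p n, u⟫) atTop (𝓝 ⟪z, u⟫) := by
  obtain ⟨z₀, hz₀⟩ := hne
  have hb : ∀ n, ‖p n‖ ≤ ‖p 0 - z₀‖ + ‖z₀‖ := fun n =>
    (norm_le_norm_sub_add _ z₀).trans (add_le_add_left (hanti z₀ hz₀ (Nat.zero_le n)) _)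
  have hlim : ∀ U : Ultrafilter ℕ, (U : Filter ℕ) ≤ atTop →
      ∃ z ∈ S, ∀ u, Tendsto (fun n => ⟪p n, u⟫) U (𝓝 ⟪z, u⟫) := fun U hU => by
    obtain ⟨z, hz⟩ := exists_weak_limit_ultrafilter U p hb
    exact ⟨z, hcluster U z hU hz, hz⟩
  have hconv : ∀ z ∈ S, ∃ d, Tendsto (fun n => ‖p n - z‖) atTop (𝓝 d) := fun z hz =>
    ⟨_, tendsto_atTop_ciInf (hanti z hz) ⟨0, by rintro _ ⟨n, rfl⟩; exact norm_nonneg _⟩⟩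
  obtain ⟨U₀, hU₀⟩ := Ultrafilter.exists_le (atTop : Filter ℕ)
  obtain ⟨z, hzS, hz⟩ := hlim U₀ hU₀
  refine ⟨z, hzS, fun u => ?_⟩
  rw [tendsto_iff_ultrafilter]
  intro U hU
  obtain ⟨w, hwS, hw⟩ := hlim U hU
  obtain ⟨d, hd⟩ := hconv z hzS
  obtain ⟨e, he⟩ := hconv w hwS
  have hdiff : Tendsto (fun n => ⟪p n, w - z⟫) atTop
      (𝓝 ((d ^ 2 - e ^ 2 - ‖z‖ ^ 2 + ‖w‖ ^ 2) / 2)) := by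
    refine (((((hd.pow 2).sub (he.pow 2)).sub_const (‖z‖ ^ 2)).add_const
      (‖w‖ ^ 2)).div_const 2).congr fun n => ?_
    simp only [norm_sub_sq_real, inner_sub_right]
    ring
  have h1 := tendsto_nhds_unique (hz (w - z)) (hdiff.mono_left hU₀)
  have h2 := tendsto_nhds_unique (hw (w - z)) (hdiff.mono_left hU)
  have h3 : ⟪w - z, w - z⟫ = 0 := by rw [inner_sub_left, h1, h2, sub_self]
  have h4 : w = z := sub_eq_zero.1 (inner_self_eq_zero.1 h3)
  rw [← h4]
  exact hw u

/-- Weak convergence of the relaxed projection scheme onto the half-spaces cut out by points of the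
graph of `T + Q`. -/
theorem exists_weak_limit_of_projective_splitting [CompleteSpace H] {T : H → Set H}
    (hTmono : ∀ x y u v, u ∈ T x → v ∈ T y → (0 : ℝ) ≤ ⟪x - y, u - v⟫)
    (hTmax : ∀ x u, (∀ y v, v ∈ T y → (0 : ℝ) ≤ ⟪x - y, u - v⟫) → u ∈ T x)
    {Q : H → H} {K : ℝ} (hQmono : ∀ x y, (0 : ℝ) ≤ ⟪x - y, Q x - Q y⟫)
    (hQlip : ∀ x y, ‖Q x - Q y‖ ≤ K * ‖x - y‖) (hzer : ∃ z, -Q z ∈ T z)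
    {lam ρ : ℕ → ℝ} {lo hi : ℝ} (hlo : 0 < lo) (hlo' : ∀ n, lo ≤ lam n)
    (hhi : hi < 2) (hhi' : ∀ n, lam n ≤ hi)
    {p pt m ms : ℕ → H} (hmem : ∀ n, ms n - Q (m n) ∈ T (m n))
    {c₁ c₂ : ℝ} (hc₁ : 0 < c₁) (hcoer : ∀ n, c₁ * ‖pt n - m n‖ ^ 2 ≤ ⟪pt n - m n, ms n⟫)
    (hc₂ : 0 < c₂) (hbound : ∀ n, ‖ms n‖ ≤ c₂ * ‖pt n - m n‖)
    (hρ : ∀ n, ρ n = if ⟪m n - p n, ms n⟫ < 0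
      then lam n * ⟪m n - p n, ms n⟫ / ‖ms n‖ ^ 2 else 0)
    (hrec : ∀ n, p (n + 1) = p n + ρ n • ms n)
    (hpt : Tendsto (fun n => pt n - p n) atTop (𝓝 0)) :
    ∃ z, -Q z ∈ T z ∧ ∀ u, Tendsto (fun n => ⟪p n, u⟫) atTop (𝓝 ⟪z, u⟫) := by
  set θ : ℕ → ℝ := fun n => ⟪m n - p n, ms n⟫ with hθ
  -- the Fejér gain of the `n`-th step
  set g : ℕ → ℝ := fun n => if θ n < 0 then θ n ^ 2 / ‖ms n‖ ^ 2 else 0 with hg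
  have hg0 : ∀ n, 0 ≤ g n := by
    intro n
    simp only [hg]
    split_ifs <;> positivity
  have hη : 0 < lo * (2 - hi) := mul_pos hlo (by linarith)
  have hfejer : ∀ z, -Q z ∈ T z → ∀ n,
      ‖p (n + 1) - z‖ ^ 2 ≤ ‖p n - z‖ ^ 2 - lo * (2 - hi) * g n := by
    intro z hz n
    have hmon : 0 ≤ ⟪m n - z, ms n⟫ := by
      have h1 := hTmono _ _ _ _ (hmem n) hz
      have h2 := hQmono (m n) z
      have : ms n = (ms n - Q (m n) - -Q z) + (Q (m n) - Q z) := by abel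
      rw [this, inner_add_right]
      exact add_nonneg h1 h2
    have hsplit : ⟪p n - z, ms n⟫ = ⟪m n - z, ms n⟫ - θ n := by
      simp only [hθ, inner_sub_left]
      ring
    have hexp : ‖p (n + 1) - z‖ ^ 2
        = ‖p n - z‖ ^ 2 + 2 * (ρ n * ⟪p n - z, ms n⟫) + ρ n ^ 2 * ‖ms n‖ ^ 2 := by
      rw [hrec n, add_sub_right_comm, norm_add_sq_real, inner_smul_right, norm_smul, mul_pow,
        Real.norm_eq_abs, sq_abs]
    by_cases hneg : θ n < 0
    · have hms : 0 < ‖ms n‖ ^ 2 := by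
        have : ms n ≠ 0 := by
          intro h0
          simp [hθ, h0] at hneg
        positivity
      have hρn : ρ n = lam n * θ n / ‖ms n‖ ^ 2 := by rw [hρ n, if_pos hneg]
      have hgn : g n = θ n ^ 2 / ‖ms n‖ ^ 2 := by simp only [hg, if_pos hneg]
      have hlam : 0 < lam n := hlo.trans_le (hlo' n)
      have hρ0 : ρ n ≤ 0 := by
        rw [hρn]
        exact div_nonpos_of_nonpos_of_nonneg (by nlinarith) hms.le
      have e1 : ρ n * θ n = lam n * g n := by rw [hρn, hgn]; ring
      have e2 : ρ n ^ 2 * ‖ms n‖ ^ 2 = lam n ^ 2 * g n := by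
        rw [hρn, hgn]
        field_simp
      have e3 : lo * (2 - hi) ≤ lam n * (2 - lam n) :=
        mul_le_mul (hlo' n) (by linarith [hhi' n]) (by linarith) hlam.le
      have e4 := mul_le_mul_of_nonneg_right e3 (hg0 n)
      have e5 : ρ n * ⟪m n - z, ms n⟫ ≤ 0 := mul_nonpos_of_nonpos_of_nonneg hρ0 hmon
      rw [hexp, hsplit, e2, mul_sub, e1]
      nlinarith
    · have hρn : ρ n = 0 := by rw [hρ n, if_neg hneg]
      have hgn : g n = 0 := by simp only [hg, if_neg hneg]
      rw [hexp, hρn, hgn]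
      simp
  have hanti : ∀ z ∈ {z | -Q z ∈ T z}, Antitone fun n => ‖p n - z‖ := by
    intro z hz
    refine antitone_nat_of_succ_le fun n => ?_
    refine le_of_sq_le_sq ((hfejer z hz n).trans ?_) (norm_nonneg _)
    have := mul_nonneg hη.le (hg0 n)
    linarith
  obtain ⟨z₀, hz₀⟩ := hzer
  have hgsum : Tendsto g atTop (𝓝 0) := by
    have hd : Tendsto (fun n => ‖p n - z₀‖) atTop (𝓝 (⨅ n, ‖p n - z₀‖)) :=
      tendsto_atTop_ciInf (hanti z₀ hz₀) ⟨0, by rintro _ ⟨n, rfl⟩; exact norm_nonneg _⟩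
    have hd2 := hd.pow 2
    have hd3 := (hd2.sub (hd2.comp (tendsto_add_atTop_nat 1))).div_const (lo * (2 - hi))
    rw [sub_self, zero_div] at hd3
    refine squeeze_zero hg0 (fun n => ?_) hd3
    rw [le_div_iff₀ hη]
    have := hfejer z₀ hz₀ n
    simp only [Function.comp_apply]
    linarith
  have hdist : Tendsto (fun n => pt n - m n) atTop (𝓝 0) := by
    have hub : ∀ n, ‖pt n - m n‖
        ≤ 2 * c₂ / c₁ * ‖pt n - p n‖ + 2 * c₂ / c₁ * √(g n) := by
      intro n
      set d := ‖pt n - m n‖ with hdd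
      have hd0 : 0 ≤ d := norm_nonneg _
      have hs : 0 ≤ 2 * c₂ / c₁ * √(g n) := by positivity
      by_cases hcase : d ≤ 2 * c₂ / c₁ * ‖pt n - p n‖
      · linarith
      push Not at hcase
      have hdpos : 0 < d := lt_of_le_of_lt (by positivity) hcase
      have hcase' : c₂ * ‖pt n - p n‖ < c₁ * d / 2 := by
        rw [div_mul_eq_mul_div, div_lt_iff₀ hc₁] at hcase
        linarith
      have h1 : ⟪pt n - p n, ms n⟫ ≤ ‖pt n - p n‖ * (c₂ * d) :=
        (real_inner_le_norm _ _).trans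
          (mul_le_mul_of_nonneg_left (hbound n) (norm_nonneg _))
      have h2 : θ n = ⟪pt n - p n, ms n⟫ - ⟪pt n - m n, ms n⟫ := by
        simp only [hθ, inner_sub_left]
        ring
      have h3 : θ n ≤ -(c₁ * d ^ 2 / 2) := by
        have := hcoer n
        nlinarith
      have hneg : θ n < 0 := h3.trans_lt (by rw [neg_lt_zero]; positivity)
      have hms : 0 < ‖ms n‖ := by
        rw [norm_pos_iff]
        intro h0
        simp [hθ, h0] at hneg
      have hgn : √(g n) = -θ n / ‖ms n‖ := by
        simp only [hg, if_pos hneg]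
        rw [← div_pow, Real.sqrt_sq_eq_abs, abs_div, abs_of_neg hneg, abs_of_pos hms]
      have h4 : c₁ * d / (2 * c₂) ≤ √(g n) := by
        rw [hgn, div_le_div_iff₀ (by positivity) hms]
        have h5 : c₁ * d * ‖ms n‖ ≤ c₁ * d * (c₂ * d) :=
          mul_le_mul_of_nonneg_left (hbound n) (by positivity)
        nlinarith
      have h6 : d ≤ 2 * c₂ / c₁ * √(g n) := by
        have := mul_le_mul_of_nonneg_left h4 (show 0 ≤ 2 * c₂ / c₁ by positivity)
        have e : 2 * c₂ / c₁ * (c₁ * d / (2 * c₂)) = d := by field_simp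
        linarith
      have : 0 ≤ 2 * c₂ / c₁ * ‖pt n - p n‖ := by positivity
      linarith
    rw [tendsto_zero_iff_norm_tendsto_zero]
    refine squeeze_zero (fun n => norm_nonneg _) hub ?_
    have h1 := hpt.norm.const_mul (2 * c₂ / c₁)
    have h2 := hgsum.sqrt.const_mul (2 * c₂ / c₁)
    simpa using h1.add h2
  have hms : Tendsto ms atTop (𝓝 0) := by
    rw [tendsto_zero_iff_norm_tendsto_zero]
    refine squeeze_zero (fun n => norm_nonneg _) hbound ?_
    simpa using hdist.norm.const_mul c₂
  have hmp : Tendsto (fun n => m n - p n) atTop (𝓝 0) := by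
    simpa using hpt.sub hdist
  obtain ⟨R, hR⟩ := (Metric.isBounded_range_of_tendsto _ hmp).exists_norm_le
  have hmb : ∀ n, ‖m n‖ ≤ R + (‖p 0 - z₀‖ + ‖z₀‖) := by
    intro n
    have h1 := hR _ ⟨n, rfl⟩
    have h2 := hanti z₀ hz₀ (Nat.zero_le n)
    have h3 := norm_le_norm_sub_add (m n) (p n)
    have h4 := norm_le_norm_sub_add (p n) z₀
    simp only at h1 h2
    linarith
  refine exists_weak_limit_of_opial (S := {z | -Q z ∈ T z}) ⟨z₀, hz₀⟩ hanti fun U z hU hz => ?_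
  refine neg_mem_of_weak_limit hTmono hTmax hQmono hQlip U hmb (hms.mono_left hU) hmem fun u => ?_
  have h1 : Tendsto (fun n => ⟪u, m n - p n⟫) U (𝓝 0) :=
    tendsto_inner_of_norm_le (R := ‖u‖) (fun _ => le_rfl) (hmp.mono_left hU)
  have h2 := (hz u).add h1
  rw [add_zero] at h2
  refine h2.congr fun n => ?_
  rw [real_inner_comm, ← inner_add_right, add_sub_cancel, real_inner_comm]

end Abstract

section KuhnTucker

variable {I J : Type*} {Y : I → Type*} [∀ i, NormedAddCommGroup (Y i)]
  {Z : J → Type*} [∀ j, NormedAddCommGroup (Z j)]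

/-- The Hilbert direct sum of the primal, auxiliary and dual spaces. -/
abbrev TripleSum (Y : I → Type*) [∀ i, NormedAddCommGroup (Y i)]
    (Z : J → Type*) [∀ j, NormedAddCommGroup (Z j)] : Type _ :=
  WithLp 2 (PiLp 2 Y × WithLp 2 (PiLp 2 Z × PiLp 2 Z))

namespace TripleSum

/-- The element of the direct sum with given components. -/
def mk (x : ∀ i, Y i) (y v : ∀ j, Z j) : TripleSum Y Z :=
  WithLp.toLp 2 (WithLp.toLp 2 x, WithLp.toLp 2 (WithLp.toLp 2 y, WithLp.toLp 2 v))

/-- The primal component. -/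
def px (z : TripleSum Y Z) (i : I) : Y i := z.ofLp.1 i

/-- The auxiliary component. -/
def py (z : TripleSum Y Z) (j : J) : Z j := z.ofLp.2.ofLp.1 j

/-- The dual component. -/
def pv (z : TripleSum Y Z) (j : J) : Z j := z.ofLp.2.ofLp.2 j

@[simp] theorem px_mk (x : ∀ i, Y i) (y v : ∀ j, Z j) : px (mk x y v) = x := rfl
@[simp] theorem py_mk (x : ∀ i, Y i) (y v : ∀ j, Z j) : py (mk x y v) = y := rfl
@[simp] theorem pv_mk (x : ∀ i, Y i) (y v : ∀ j, Z j) : pv (mk x y v) = v := rfl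

@[simp] theorem px_sub (z w : TripleSum Y Z) (i : I) : px (z - w) i = px z i - px w i := rfl
@[simp] theorem py_sub (z w : TripleSum Y Z) (j : J) : py (z - w) j = py z j - py w j := rfl
@[simp] theorem pv_sub (z w : TripleSum Y Z) (j : J) : pv (z - w) j = pv z j - pv w j := rfl
@[simp] theorem px_neg (z : TripleSum Y Z) (i : I) : px (-z) i = -px z i := rfl
@[simp] theorem py_neg (z : TripleSum Y Z) (j : J) : py (-z) j = -py z j := rfl
@[simp] theorem pv_neg (z : TripleSum Y Z) (j : J) : pv (-z) j = -pv z j := rfl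

variable [∀ i, InnerProductSpace ℝ (Y i)] [∀ j, InnerProductSpace ℝ (Z j)]

theorem mk_add_smul (x x' : ∀ i, Y i) (y v y' v' : ∀ j, Z j) (t : ℝ) :
    mk x y v + t • mk x' y' v'
      = mk (fun i => x i + t • x' i) (fun j => y j + t • y' j) (fun j => v j + t • v' j) := rfl

variable [Fintype I] [Fintype J]

theorem inner_eq (z w : TripleSum Y Z) :
    ⟪z, w⟫ = ∑ i, ⟪px z i, px w i⟫ + ∑ j, (⟪py z j, py w j⟫ + ⟪pv z j, pv w j⟫) := by
  rw [WithLp.prod_inner_apply, WithLp.prod_inner_apply, PiLp.inner_apply, PiLp.inner_apply,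
    PiLp.inner_apply, Finset.sum_add_distrib]
  rfl

theorem norm_sq_eq (z : TripleSum Y Z) :
    ‖z‖ ^ 2 = ∑ i, ‖px z i‖ ^ 2 + ∑ j, (‖py z j‖ ^ 2 + ‖pv z j‖ ^ 2) := by
  simp only [← real_inner_self_eq_norm_sq, inner_eq]

theorem norm_px_le (z : TripleSum Y Z) (i : I) : ‖px z i‖ ≤ ‖z‖ := by
  refine le_of_sq_le_sq ?_ (norm_nonneg _)
  rw [norm_sq_eq]
  have h1 := Finset.single_le_sum (f := fun i => ‖px z i‖ ^ 2) (fun _ _ => by positivity)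
    (Finset.mem_univ i)
  have h2 : 0 ≤ ∑ j, (‖py z j‖ ^ 2 + ‖pv z j‖ ^ 2) := by positivity
  linarith

theorem norm_py_sq_add_norm_pv_sq_le (z : TripleSum Y Z) (j : J) :
    ‖py z j‖ ^ 2 + ‖pv z j‖ ^ 2 ≤ ‖z‖ ^ 2 := by
  rw [norm_sq_eq]
  have h1 := Finset.single_le_sum (f := fun j => ‖py z j‖ ^ 2 + ‖pv z j‖ ^ 2)
    (fun _ _ => by positivity) (Finset.mem_univ j)
  have h2 : 0 ≤ ∑ i, ‖px z i‖ ^ 2 := by positivity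
  linarith

theorem norm_py_le (z : TripleSum Y Z) (j : J) : ‖py z j‖ ≤ ‖z‖ :=
  le_of_sq_le_sq (by nlinarith [norm_py_sq_add_norm_pv_sq_le z j, sq_nonneg ‖pv z j‖])
    (norm_nonneg _)

theorem norm_pv_le (z : TripleSum Y Z) (j : J) : ‖pv z j‖ ≤ ‖z‖ :=
  le_of_sq_le_sq (by nlinarith [norm_py_sq_add_norm_pv_sq_le z j, sq_nonneg ‖py z j‖])
    (norm_nonneg _)

theorem norm_le (z : TripleSum Y Z) :
    ‖z‖ ≤ ∑ i, ‖px z i‖ + ∑ j, ‖py z j‖ + ∑ j, ‖pv z j‖ := by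
  have hx : 0 ≤ ∑ i, ‖px z i‖ := by positivity
  have hy : 0 ≤ ∑ j, ‖py z j‖ := by positivity
  have hv : 0 ≤ ∑ j, ‖pv z j‖ := by positivity
  refine le_of_sq_le_sq ?_ (by positivity)
  rw [norm_sq_eq, Finset.sum_add_distrib]
  have h1 := Finset.sum_sq_le_sq_sum_of_nonneg (s := Finset.univ) (f := fun i => ‖px z i‖)
    fun _ _ => norm_nonneg _
  have h2 := Finset.sum_sq_le_sq_sum_of_nonneg (s := Finset.univ) (f := fun j => ‖py z j‖)
    fun _ _ => norm_nonneg _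
  have h3 := Finset.sum_sq_le_sq_sum_of_nonneg (s := Finset.univ) (f := fun j => ‖pv z j‖)
    fun _ _ => norm_nonneg _
  nlinarith [mul_nonneg hx hy, mul_nonneg hx hv, mul_nonneg hy hv]

/-- Componentwise linear bounds combine into a bound on the whole vector. -/
theorem exists_norm_le_mul {ι : Type*} {z : ι → TripleSum Y Z} {N : ι → ℝ} (hN : ∀ n, 0 ≤ N n)
    (hx : ∀ i, ∃ K, ∀ n, ‖px (z n) i‖ ≤ K * N n) (hy : ∀ j, ∃ K, ∀ n, ‖py (z n) j‖ ≤ K * N n)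
    (hv : ∀ j, ∃ K, ∀ n, ‖pv (z n) j‖ ≤ K * N n) : ∃ K, 0 < K ∧ ∀ n, ‖z n‖ ≤ K * N n := by
  choose Kx hKx using hx
  choose Ky hKy using hy
  choose Kv hKv using hv
  refine ⟨|∑ i, Kx i + ∑ j, Ky j + ∑ j, Kv j| + 1, by positivity, fun n => ?_⟩
  calc ‖z n‖ ≤ ∑ i, ‖px (z n) i‖ + ∑ j, ‖py (z n) j‖ + ∑ j, ‖pv (z n) j‖ := norm_le _
    _ ≤ ∑ i, Kx i * N n + ∑ j, Ky j * N n + ∑ j, Kv j * N n := by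
        gcongr with i _ j _ j _
        exacts [hKx i n, hKy j n, hKv j n]
    _ = (∑ i, Kx i + ∑ j, Ky j + ∑ j, Kv j) * N n := by simp only [← Finset.sum_mul, add_mul]
    _ ≤ _ := mul_le_mul_of_nonneg_right ((le_abs_self _).trans (by linarith)) (hN n)

theorem tendsto_zero {ι : Type*} {l : Filter ι} {z : ι → TripleSum Y Z}
    (hx : ∀ i, Tendsto (fun n => px (z n) i) l (𝓝 0))
    (hy : ∀ j, Tendsto (fun n => py (z n) j) l (𝓝 0))
    (hv : ∀ j, Tendsto (fun n => pv (z n) j) l (𝓝 0)) : Tendsto z l (𝓝 0) := by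
  rw [tendsto_zero_iff_norm_tendsto_zero]
  refine squeeze_zero (fun n => norm_nonneg _) (fun n => norm_le (z n)) ?_
  have h1 := tendsto_finsetSum Finset.univ fun i (_ : i ∈ Finset.univ) => (hx i).norm
  have h2 := tendsto_finsetSum Finset.univ fun j (_ : j ∈ Finset.univ) => (hy j).norm
  have h3 := tendsto_finsetSum Finset.univ fun j (_ : j ∈ Finset.univ) => (hv j).norm
  simpa using (h1.add h2).add h3

theorem inner_mk_single_left [DecidableEq I] (z : TripleSum Y Z) (i : I) (u : Y i) :
    ⟪z, mk (Pi.single i u) 0 0⟫ = ⟪px z i, u⟫ := by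
  rw [inner_eq, Finset.sum_eq_single i]
  · simp
  · intro k _ hk
    simp [hk]
  · simp

theorem inner_mk_single_right [DecidableEq J] (z : TripleSum Y Z) (j : J) (u : Z j) :
    ⟪z, mk 0 0 (Pi.single j u)⟫ = ⟪pv z j, u⟫ := by
  rw [inner_eq, Finset.sum_eq_zero (s := (Finset.univ : Finset I)), Finset.sum_eq_single j]
  · simp
  · intro k _ hk
    simp [hk]
  · simp
  · simp

end TripleSum

open TripleSum

variable [Fintype I] [Fintype J]
  [∀ i, InnerProductSpace ℝ (Y i)] [∀ j, InnerProductSpace ℝ (Z j)]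

/-- A maximally monotone operator contains every point monotonically related to its graph. -/
theorem mem_of_monotonically_related {E : Type*} [NormedAddCommGroup E] [InnerProductSpace ℝ E]
    {A : E → Set E} (hmono : ∀ x y u v, u ∈ A x → v ∈ A y → (0 : ℝ) ≤ ⟪x - y, u - v⟫)
    (hmax : ∀ A' : E → Set E, (∀ x y u v, u ∈ A' x → v ∈ A' y → (0 : ℝ) ≤ ⟪x - y, u - v⟫) →
      (∀ x, A x ⊆ A' x) → ∀ x, A' x ⊆ A x)
    (x u : E) (h : ∀ y v, v ∈ A y → (0 : ℝ) ≤ ⟪x - y, u - v⟫) : u ∈ A x := by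
  refine hmax (fun y => {w | w ∈ A y ∨ y = x ∧ w = u}) ?_ (fun _ _ => Or.inl) x (Or.inr ⟨rfl, rfl⟩)
  rintro y y' w w' (hw | ⟨rfl, rfl⟩) (hw' | ⟨rfl, rfl⟩)
  · exact hmono _ _ _ _ hw hw'
  · have := h _ _ hw
    rwa [← neg_sub, ← neg_sub w, inner_neg_neg] at this
  · exact h _ _ hw'
  · simp

/-- Test point deciding membership in the graph of an operator closed under monotone relation. -/
theorem exists_test_point {E : Type*} [NormedAddCommGroup E] [InnerProductSpace ℝ E]
    {A : E → Set E} (hmax : ∀ x u, (∀ y v, v ∈ A y → (0 : ℝ) ≤ ⟪x - y, u - v⟫) → u ∈ A x)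
    (x u : E) : ∃ y v, v ∈ A y ∧ ⟪x - y, u - v⟫ ≤ 0 ∧ (0 ≤ ⟪x - y, u - v⟫ → u ∈ A x) := by
  by_cases hu : u ∈ A x
  · exact ⟨x, u, hu, by simp, fun _ => hu⟩
  · have := mt (hmax x u) hu
    push Not at this
    obtain ⟨y, v, hv, hlt⟩ := this
    exact ⟨y, v, hv, hlt.le, fun h => absurd h hlt.not_ge⟩

/-- The product of two families of operators with the zero operator. -/
def productOperator (A : ∀ i, Y i → Set (Y i)) (B : ∀ j, Z j → Set (Z j)) (z : TripleSum Y Z) :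
    Set (TripleSum Y Z) :=
  {u | (∀ i, px u i ∈ A i (px z i)) ∧ (∀ j, py u j ∈ B j (py z j)) ∧ ∀ j, pv u j = 0}

theorem productOperator_monotone {A : ∀ i, Y i → Set (Y i)} {B : ∀ j, Z j → Set (Z j)}
    (hA : ∀ i x y u v, u ∈ A i x → v ∈ A i y → (0 : ℝ) ≤ ⟪x - y, u - v⟫)
    (hB : ∀ j x y u v, u ∈ B j x → v ∈ B j y → (0 : ℝ) ≤ ⟪x - y, u - v⟫)
    (z w p q : TripleSum Y Z) (hp : p ∈ productOperator A B z) (hq : q ∈ productOperator A B w) :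
    0 ≤ ⟪z - w, p - q⟫ := by
  rw [inner_eq]
  refine add_nonneg (Finset.sum_nonneg fun i _ => hA i _ _ _ _ (hp.1 i) (hq.1 i))
    (Finset.sum_nonneg fun j _ => add_nonneg (hB j _ _ _ _ (hp.2.1 j) (hq.2.1 j)) ?_)
  simp [hp.2.2 j, hq.2.2 j]

theorem productOperator_maximal {A : ∀ i, Y i → Set (Y i)} {B : ∀ j, Z j → Set (Z j)}
    (hA : ∀ i x u, (∀ y v, v ∈ A i y → (0 : ℝ) ≤ ⟪x - y, u - v⟫) → u ∈ A i x)
    (hB : ∀ j x u, (∀ y v, v ∈ B j y → (0 : ℝ) ≤ ⟪x - y, u - v⟫) → u ∈ B j x)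
    (z p : TripleSum Y Z)
    (h : ∀ w q, q ∈ productOperator A B w → (0 : ℝ) ≤ ⟪z - w, p - q⟫) :
    p ∈ productOperator A B z := by
  choose ax au hau hale hamem using fun i => exists_test_point (hA i) (px z i) (px p i)
  choose bx bu hbu hble hbmem using fun j => exists_test_point (hB j) (py z j) (py p j)
  have hdual : ∀ j, ⟪-pv p j, pv p j⟫ ≤ 0 := fun j => by
    rw [inner_neg_left, neg_nonpos]
    exact real_inner_self_nonneg
  have hrel := h (mk ax bx fun j => pv z j + pv p j) (mk au bu 0) ⟨hau, hbu, fun _ => rfl⟩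
  simp only [inner_eq, px_sub, py_sub, pv_sub, px_mk, py_mk, pv_mk, Pi.zero_apply, sub_zero,
    sub_add_cancel_left, Finset.sum_add_distrib] at hrel
  have ha := Finset.sum_nonpos fun i (_ : i ∈ Finset.univ) => hale i
  have hb := Finset.sum_nonpos fun j (_ : j ∈ Finset.univ) => hble j
  have hv := Finset.sum_nonpos fun j (_ : j ∈ Finset.univ) => hdual j
  refine ⟨fun i => hamem i ?_, fun j => hbmem j ?_, fun j => ?_⟩
  · exact ((Finset.sum_eq_zero_iff_of_nonpos fun i _ => hale i).1
      (by linarith) i (Finset.mem_univ i)).ge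
  · exact ((Finset.sum_eq_zero_iff_of_nonpos fun j _ => hble j).1
      (by linarith) j (Finset.mem_univ j)).ge
  · have := (Finset.sum_eq_zero_iff_of_nonpos fun j _ => hdual j).1
      (by linarith) j (Finset.mem_univ j)
    rwa [inner_neg_left, neg_eq_zero, inner_self_eq_zero] at this

theorem exists_norm_sum_clm_le {ι : Type*} [Fintype ι] {E : ι → Type*}
    [∀ k, NormedAddCommGroup (E k)] [∀ k, InnerProductSpace ℝ (E k)] {G : Type*}
    [NormedAddCommGroup G] [InnerProductSpace ℝ G] (S : ∀ k, E k →L[ℝ] G) :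
    ∃ K : ℝ, ∀ (w : ∀ k, E k) (N : ℝ), (∀ k, ‖w k‖ ≤ N) → ‖∑ k, S k (w k)‖ ≤ K * N := by
  refine ⟨∑ k, ‖S k‖, fun w N hw => ?_⟩
  rw [Finset.sum_mul]
  exact norm_sum_le_of_le _ fun k _ =>
    ((S k).le_opNorm _).trans (mul_le_mul_of_nonneg_left (hw k) (norm_nonneg _))

variable [∀ i, CompleteSpace (Y i)] [∀ j, CompleteSpace (Z j)]

theorem sum_inner_sum_adjoint (L : ∀ j i, Y i →L[ℝ] Z j) (x : ∀ i, Y i) (v : ∀ j, Z j) :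
    ∑ i, ⟪x i, ∑ j, (L j i).adjoint (v j)⟫ = ∑ j, ⟪v j, ∑ i, L j i (x i)⟫ := by
  simp only [inner_sum, ContinuousLinearMap.adjoint_inner_right]
  rw [Finset.sum_comm]
  exact Finset.sum_congr rfl fun j _ => Finset.sum_congr rfl fun i _ => real_inner_comm _ _

/-- The single-valued part of the saddle operator. -/
noncomputable def saddleOperator (C : ∀ i, Y i → Y i) (D : ∀ j, Z j → Z j) (L : ∀ j i, Y i →L[ℝ] Z j)
    (s : ∀ i, Y i) (r : ∀ j, Z j) (z : TripleSum Y Z) : TripleSum Y Z :=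
  mk (fun i => C i (px z i) + ∑ j, (L j i).adjoint (pv z j) - s i)
    (fun j => D j (py z j) - pv z j)
    (fun j => r j + py z j - ∑ i, L j i (px z i))

theorem px_saddleOperator_sub (C : ∀ i, Y i → Y i) (D : ∀ j, Z j → Z j)
    (L : ∀ j i, Y i →L[ℝ] Z j) (s : ∀ i, Y i) (r : ∀ j, Z j) (z w : TripleSum Y Z) (i : I) :
    px (saddleOperator C D L s r z - saddleOperator C D L s r w) i
      = (C i (px z i) - C i (px w i)) + ∑ j, (L j i).adjoint (pv (z - w) j) := by
  simp only [saddleOperator, px_sub, pv_sub, px_mk, map_sub, Finset.sum_sub_distrib]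
  abel

theorem py_saddleOperator_sub (C : ∀ i, Y i → Y i) (D : ∀ j, Z j → Z j)
    (L : ∀ j i, Y i →L[ℝ] Z j) (s : ∀ i, Y i) (r : ∀ j, Z j) (z w : TripleSum Y Z) (j : J) :
    py (saddleOperator C D L s r z - saddleOperator C D L s r w) j
      = (D j (py z j) - D j (py w j)) - pv (z - w) j := by
  simp only [saddleOperator, py_sub, pv_sub, py_mk]
  abel

theorem pv_saddleOperator_sub (C : ∀ i, Y i → Y i) (D : ∀ j, Z j → Z j)
    (L : ∀ j i, Y i →L[ℝ] Z j) (s : ∀ i, Y i) (r : ∀ j, Z j) (z w : TripleSum Y Z) (j : J) :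
    pv (saddleOperator C D L s r z - saddleOperator C D L s r w) j
      = py (z - w) j - ∑ i, L j i (px (z - w) i) := by
  simp only [saddleOperator, px_sub, py_sub, pv_sub, pv_mk, map_sub, Finset.sum_sub_distrib]
  abel

theorem saddleOperator_monotone {C : ∀ i, Y i → Y i} {D : ∀ j, Z j → Z j}
    (hC : ∀ i x y, (0 : ℝ) ≤ ⟪x - y, C i x - C i y⟫)
    (hD : ∀ j x y, (0 : ℝ) ≤ ⟪x - y, D j x - D j y⟫)
    (L : ∀ j i, Y i →L[ℝ] Z j) (s : ∀ i, Y i) (r : ∀ j, Z j) (z w : TripleSum Y Z) :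
    0 ≤ ⟪z - w, saddleOperator C D L s r z - saddleOperator C D L s r w⟫ := by
  have hadj := sum_inner_sum_adjoint L (px (z - w)) (pv (z - w))
  have h1 := Finset.sum_nonneg fun i (_ : i ∈ Finset.univ) => hC i (px z i) (px w i)
  have h2 := Finset.sum_nonneg fun j (_ : j ∈ Finset.univ) => hD j (py z j) (py w j)
  rw [inner_eq]
  simp only [px_saddleOperator_sub, py_saddleOperator_sub, pv_saddleOperator_sub, inner_add_right,
    inner_sub_right, Finset.sum_add_distrib, Finset.sum_sub_distrib] at hadj h1 h2 ⊢
  rw [hadj]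
  have hcomm : ∑ j, ⟪py (z - w) j, pv (z - w) j⟫ = ∑ j, ⟪pv (z - w) j, py (z - w) j⟫ :=
    Finset.sum_congr rfl fun j _ => real_inner_comm _ _
  rw [hcomm]
  simp only [px_sub, py_sub] at h1 h2 ⊢
  linarith

theorem saddleOperator_lipschitz {C : ∀ i, Y i → Y i} {μ : I → ℝ} (hμ : ∀ i, 0 < μ i)
    (hC : ∀ i x y, ‖C i x - C i y‖ ≤ μ i * ‖x - y‖) {D : ∀ j, Z j → Z j} {ν : J → ℝ}
    (hν : ∀ j, 0 < ν j) (hD : ∀ j x y, ‖D j x - D j y‖ ≤ ν j * ‖x - y‖)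
    (L : ∀ j i, Y i →L[ℝ] Z j) (s : ∀ i, Y i) (r : ∀ j, Z j) :
    ∃ K, ∀ z w : TripleSum Y Z,
      ‖saddleOperator C D L s r z - saddleOperator C D L s r w‖ ≤ K * ‖z - w‖ := by
  suffices h : ∃ K, 0 < K ∧ ∀ q : TripleSum Y Z × TripleSum Y Z,
      ‖saddleOperator C D L s r q.1 - saddleOperator C D L s r q.2‖ ≤ K * ‖q.1 - q.2‖ by
    obtain ⟨K, -, hK⟩ := h
    exact ⟨K, fun z w => hK (z, w)⟩
  refine exists_norm_le_mul (fun _ => norm_nonneg _) ?_ ?_ ?_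
  · intro i
    obtain ⟨K, hK⟩ := exists_norm_sum_clm_le fun j => (L j i).adjoint
    refine ⟨μ i + K, fun ⟨z, w⟩ => ?_⟩
    rw [px_saddleOperator_sub, add_mul]
    refine norm_add_le_of_le ((hC i _ _).trans ?_) (hK _ _ fun j => norm_pv_le _ _)
    exact mul_le_mul_of_nonneg_left (norm_px_le (z - w) i) (hμ i).le
  · intro j
    refine ⟨ν j + 1, fun ⟨z, w⟩ => ?_⟩
    rw [py_saddleOperator_sub, add_mul, one_mul]
    refine norm_sub_le_of_le ((hD j _ _).trans ?_) (norm_pv_le _ _)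
    exact mul_le_mul_of_nonneg_left (norm_py_le (z - w) j) (hν j).le
  · intro j
    obtain ⟨K, hK⟩ := exists_norm_sum_clm_le fun i => L j i
    refine ⟨1 + K, fun ⟨z, w⟩ => ?_⟩
    rw [pv_saddleOperator_sub, add_mul, one_mul]
    exact norm_sub_le_of_le (norm_py_le _ _) (hK _ _ fun i => norm_px_le _ _)

/-- Zeros of the saddle operator are Kuhn-Tucker points completed by the auxiliary variable. -/
theorem neg_saddleOperator_mem_iff {A : ∀ i, Y i → Set (Y i)} {B : ∀ j, Z j → Set (Z j)}
    {C : ∀ i, Y i → Y i} {D : ∀ j, Z j → Z j} {L : ∀ j i, Y i →L[ℝ] Z j}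
    {s : ∀ i, Y i} {r : ∀ j, Z j} {z : TripleSum Y Z} :
    -saddleOperator C D L s r z ∈ productOperator A B z ↔
      (∀ i, ∃ u ∈ A i (px z i), s i - ∑ j, (L j i).adjoint (pv z j) = u + C i (px z i)) ∧
      (∀ j, ∃ w ∈ B j (py z j), pv z j = w + D j (py z j)) ∧
      ∀ j, py z j = ∑ i, L j i (px z i) - r j := by
  simp only [productOperator, saddleOperator, Set.mem_ofPred_eq, px_neg, py_neg, pv_neg, px_mk,
    py_mk, pv_mk]
  refine and_congr (forall_congr' fun i => ?_) (and_congr (forall_congr' fun j => ?_)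
    (forall_congr' fun j => ?_))
  · constructor
    · exact fun h => ⟨_, h, by abel⟩
    · rintro ⟨u, hu, he⟩
      convert hu using 1
      rw [← sub_eq_iff_eq_add] at he
      rw [← he]
      abel
  · constructor
    · exact fun h => ⟨_, h, by abel⟩
    · rintro ⟨u, hu, he⟩
      convert hu using 1
      rw [he]
      abel
  · rw [neg_eq_zero, sub_eq_zero, eq_sub_iff_add_eq, add_comm]

end KuhnTucker

/-- Strong monotonicity of a warped forward kernel with a uniform constant. -/
theorem forward_kernel_strongly_monotone {E : Type*} [NormedAddCommGroup E] [InnerProductSpace ℝ E]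
    {α μ ε γ : ℝ} (hα : 0 < α) (hμ : 0 < μ) (hε : 0 < ε)
    (hγ : γ ∈ Set.Icc ε ((α - ε) / μ)) {d f c : E} (hf : α * ‖d‖ ^ 2 ≤ ⟪d, f⟫)
    (hc : ‖c‖ ≤ μ * ‖d‖) : ε * μ / α * ‖d‖ ^ 2 ≤ ⟪d, γ⁻¹ • f - c⟫ := by
  have hγ0 : 0 < γ := hε.trans_le hγ.1
  have h1 : γ * μ ≤ α - ε := (le_div_iff₀ hμ).1 hγ.2
  have h2 : ⟪d, c⟫ ≤ μ * ‖d‖ ^ 2 := by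
    have := (real_inner_le_norm d c).trans (mul_le_mul_of_nonneg_left hc (norm_nonneg d))
    linarith
  have h3 : γ⁻¹ * (α * ‖d‖ ^ 2) ≤ γ⁻¹ * ⟪d, f⟫ :=
    mul_le_mul_of_nonneg_left hf (inv_pos.2 hγ0).le
  have h4 : ε * μ / α ≤ γ⁻¹ * α - μ := by
    have e : γ⁻¹ * α - μ = (α - γ * μ) / γ := by field_simp
    rw [e, div_le_div_iff₀ hα hγ0]
    calc ε * μ * γ = ε * (γ * μ) := by ring
      _ ≤ ε * α := mul_le_mul_of_nonneg_left (by linarith) hε.le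
      _ ≤ (α - γ * μ) * α := mul_le_mul_of_nonneg_right (by linarith) hα.le
  have h5 := mul_le_mul_of_nonneg_right h4 (sq_nonneg ‖d‖)
  rw [inner_sub_right, inner_smul_right]
  linarith

theorem norm_forward_kernel_le {E : Type*} [NormedAddCommGroup E] [InnerProductSpace ℝ E]
    {χ μ ε γ N : ℝ} (hχ : 0 < χ) (hμ : 0 < μ) (hε : 0 < ε) (hγ : ε ≤ γ) {d f c : E}
    (hf : ‖f‖ ≤ χ * ‖d‖) (hc : ‖c‖ ≤ μ * ‖d‖) (hd : ‖d‖ ≤ N) :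
    ‖γ⁻¹ • f - c‖ ≤ (ε⁻¹ * χ + μ) * N := by
  have hγ0 : 0 < γ := hε.trans_le hγ
  rw [add_mul]
  refine norm_sub_le_of_le ?_ (hc.trans (mul_le_mul_of_nonneg_left hd hμ.le))
  rw [norm_smul, Real.norm_of_nonneg (inv_pos.2 hγ0).le, mul_assoc]
  exact mul_le_mul (inv_anti₀ hε hγ) (hf.trans (mul_le_mul_of_nonneg_left hd hχ.le))
    (norm_nonneg _) (inv_pos.2 hε).le

theorem exists_pos_le_of_finite {ι : Type*} [Finite ι] {f : ι → ℝ} (hf : ∀ k, 0 < f k) :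
    ∃ c, 0 < c ∧ ∀ k, c ≤ f k := by
  have h : ∀ᶠ c in 𝓝[>] (0 : ℝ), ∀ k, c ≤ f k :=
    eventually_all.2 fun k => nhdsWithin_le_nhds (Iic_mem_nhds (hf k))
  obtain ⟨c, hc, h0⟩ := (h.and eventually_mem_nhdsWithin).exists
  exact ⟨c, h0, hc⟩

/-- Corollary 5.5 (primal-dual splitting for a system of coupled monotone inclusions). -/
theorem stmt_6
    {I J : Type*} [Fintype I] [Fintype J]
    (Y : I → Type*) [∀ i, NormedAddCommGroup (Y i)] [∀ i, InnerProductSpace ℝ (Y i)]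
    [∀ i, CompleteSpace (Y i)]
    (Z : J → Type*) [∀ j, NormedAddCommGroup (Z j)] [∀ j, InnerProductSpace ℝ (Z j)]
    [∀ j, CompleteSpace (Z j)]
    (A : ∀ i, Y i → Set (Y i)) (B : ∀ j, Z j → Set (Z j))
    (hAmono : ∀ i x y u v, u ∈ A i x → v ∈ A i y → (0:ℝ) ≤ ⟪x - y, u - v⟫)
    (hAmax : ∀ i (A' : Y i → Set (Y i)),
      (∀ x y u v, u ∈ A' x → v ∈ A' y → (0:ℝ) ≤ ⟪x - y, u - v⟫) →
      (∀ x, A i x ⊆ A' x) → ∀ x, A' x ⊆ A i x)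
    (hBmono : ∀ j x y u v, u ∈ B j x → v ∈ B j y → (0:ℝ) ≤ ⟪x - y, u - v⟫)
    (hBmax : ∀ j (B' : Z j → Set (Z j)),
      (∀ x y u v, u ∈ B' x → v ∈ B' y → (0:ℝ) ≤ ⟪x - y, u - v⟫) →
      (∀ x, B j x ⊆ B' x) → ∀ x, B' x ⊆ B j x)
    (C : ∀ i, Y i → Y i) (μ : I → ℝ) (hμ : ∀ i, 0 < μ i)
    (hCmono : ∀ i x y, (0:ℝ) ≤ ⟪x - y, C i x - C i y⟫)
    (hClip : ∀ i x y, ‖C i x - C i y‖ ≤ μ i * ‖x - y‖)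
    (D : ∀ j, Z j → Z j) (ν : J → ℝ) (hν : ∀ j, 0 < ν j)
    (hDmono : ∀ j x y, (0:ℝ) ≤ ⟪x - y, D j x - D j y⟫)
    (hDlip : ∀ j x y, ‖D j x - D j y‖ ≤ ν j * ‖x - y‖)
    (L : ∀ j i, Y i →L[ℝ] Z j)
    (s : ∀ i, Y i) (r : ∀ j, Z j)
    -- the Kuhn-Tucker set is nonempty
    (hKT : ∃ (x : ∀ i, Y i) (v : ∀ j, Z j),
      (∀ i, ∃ u ∈ A i (x i),
        s i - ∑ j, (L j i).adjoint (v j) = u + C i (x i)) ∧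
      (∀ j, ∃ w ∈ B j (∑ k, L j k (x k) - r j),
        v j = w + D j (∑ k, L j k (x k) - r j)))
    (α χ : I → ℝ) (hα : ∀ i, 0 < α i) (hχ : ∀ i, 0 < χ i)
    (β κ : J → ℝ) (hβ : ∀ j, 0 < β j) (hκ : ∀ j, 0 < κ j)
    (ε : I → ℝ) (hε : ∀ i, ε i ∈ Set.Ioo (0:ℝ) (α i / (μ i + 1)))
    (δ : J → ℝ) (hδ : ∀ j, δ j ∈ Set.Ioo (0:ℝ) (β j / (ν j + 1)))
    (F : ∀ i, ℕ → Y i → Y i)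
    (hFsm : ∀ i n x y, α i * ‖x - y‖ ^ 2 ≤ ⟪x - y, F i n x - F i n y⟫)
    (hFlip : ∀ i n x y, ‖F i n x - F i n y‖ ≤ χ i * ‖x - y‖)
    (W : ∀ j, ℕ → Z j → Z j)
    (hWsm : ∀ j n x y, β j * ‖x - y‖ ^ 2 ≤ ⟪x - y, W j n x - W j n y⟫)
    (hWlip : ∀ j n x y, ‖W j n x - W j n y‖ ≤ κ j * ‖x - y‖)
    (γ : I → ℕ → ℝ) (hγ : ∀ i n, γ i n ∈ Set.Icc (ε i) ((α i - ε i) / μ i))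
    (τ : J → ℕ → ℝ) (hτ : ∀ j n, τ j n ∈ Set.Icc (δ j) ((β j - δ j) / ν j))
    (lam : ℕ → ℝ) (hlam : ∀ n, lam n ∈ Set.Ioo (0:ℝ) 2)
    (hlaminf : ∃ a, 0 < a ∧ ∀ n, a ≤ lam n)
    (hlamsup : ∃ b, b < 2 ∧ ∀ n, lam n ≤ b)
    -- the iterates and auxiliary sequences
    (x xt : ℕ → ∀ i, Y i) (y yt v vt : ℕ → ∀ j, Z j)
    (lstar a ostar astar : ℕ → ∀ i, Y i)
    (tstar b f c bstar cstar : ℕ → ∀ j, Z j)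
    (σ θ ρ : ℕ → ℝ)
    (hl : ∀ n i, lstar n i = F i n (xt n i) - γ i n • C i (xt n i)
        - γ i n • ∑ j, (L j i).adjoint (vt n j))
    (ha : ∀ n i, (γ i n)⁻¹ • (lstar n i + γ i n • s i - F i n (a n i)) ∈ A i (a n i))
    (ho : ∀ n i, ostar n i = (γ i n)⁻¹ • (lstar n i - F i n (a n i)) + C i (a n i))
    (ht : ∀ n j, tstar n j = W j n (yt n j) - τ j n • D j (yt n j) + τ j n • vt n j)
    (hb : ∀ n j, (τ j n)⁻¹ • (tstar n j - W j n (b n j)) ∈ B j (b n j))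
    (hf : ∀ n j, f n j = (τ j n)⁻¹ • (tstar n j - W j n (b n j)) + D j (b n j))
    (hc : ∀ n j, c n j = ∑ i, L j i (xt n i) - yt n j + vt n j - r j)
    (hastar : ∀ n i, astar n i = ostar n i + ∑ j, (L j i).adjoint (c n j))
    (hbstar : ∀ n j, bstar n j = f n j - c n j)
    (hcstar : ∀ n j, cstar n j = r j + b n j - ∑ i, L j i (a n i))
    (hσ : ∀ n, σ n = ∑ i, ‖astar n i‖ ^ 2 + ∑ j, (‖bstar n j‖ ^ 2 + ‖cstar n j‖ ^ 2))
    (hθ : ∀ n, θ n = ∑ i, ⟪a n i - x n i, astar n i⟫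
        + ∑ j, (⟪b n j - y n j, bstar n j⟫ + ⟪c n j - v n j, cstar n j⟫))
    (hρ : ∀ n, ρ n = if θ n < 0 then lam n * θ n / σ n else 0)
    (hxrec : ∀ n i, x (n + 1) i = x n i + ρ n • astar n i)
    (hyrec : ∀ n j, y (n + 1) j = y n j + ρ n • bstar n j)
    (hvrec : ∀ n j, v (n + 1) j = v n j + ρ n • cstar n j)
    -- the perturbations vanish asymptotically
    (hxt : ∀ i, Tendsto (fun n => xt n i - x n i) atTop (𝓝 0))
    (hyt : ∀ j, Tendsto (fun n => yt n j - y n j) atTop (𝓝 0))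
    (hvt : ∀ j, Tendsto (fun n => vt n j - v n j) atTop (𝓝 0)) :
    ∃ (xbar : ∀ i, Y i) (vbar : ∀ j, Z j),
      (∀ i (u : Y i), Tendsto (fun n => ⟪x n i, u⟫) atTop (𝓝 ⟪xbar i, u⟫)) ∧
      (∀ j (u : Z j), Tendsto (fun n => ⟪v n j, u⟫) atTop (𝓝 ⟪vbar j, u⟫)) ∧
      -- (x̄, v̄*) belongs to the Kuhn-Tucker set
      ((∀ i, ∃ u ∈ A i (xbar i),
          s i - ∑ j, (L j i).adjoint (vbar j) = u + C i (xbar i)) ∧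
        (∀ j, ∃ w ∈ B j (∑ k, L j k (xbar k) - r j),
          vbar j = w + D j (∑ k, L j k (xbar k) - r j))) ∧
      -- x̄ solves the primal system
      (∀ i, ∃ u ∈ A i (xbar i), ∃ q : ∀ j, Z j,
        (∀ j, ∃ w ∈ B j (∑ k, L j k (xbar k) - r j),
          q j = w + D j (∑ k, L j k (xbar k) - r j)) ∧
        s i = u + ∑ j, (L j i).adjoint (q j) + C i (xbar i)) ∧
      -- v̄* solves the dual system
      (∃ x' : ∀ i, Y i,
        (∀ i, ∃ u ∈ A i (x' i),
          s i - ∑ k, (L k i).adjoint (vbar k) = u + C i (x' i)) ∧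
        (∀ j, ∃ w ∈ B j (∑ k, L j k (x' k) - r j),
          vbar j = w + D j (∑ k, L j k (x' k) - r j))) := by
  classical
  obtain ⟨lo, hlo, hlo'⟩ := hlaminf
  obtain ⟨hi, hhi, hhi'⟩ := hlamsup
  set p : ℕ → TripleSum Y Z := fun n => .mk (x n) (y n) (v n) with hp
  set pt : ℕ → TripleSum Y Z := fun n => .mk (xt n) (yt n) (vt n) with hpt
  set m : ℕ → TripleSum Y Z := fun n => .mk (a n) (b n) (c n) with hm
  set ms : ℕ → TripleSum Y Z := fun n => .mk (astar n) (bstar n) (cstar n) with hms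
  have hγ0 : ∀ i n, γ i n ≠ 0 := fun i n => ((hε i).1.trans_le (hγ i n).1).ne'
  have hτ0 : ∀ j n, τ j n ≠ 0 := fun j n => ((hδ j).1.trans_le (hτ j n).1).ne'
  -- the dual points as increments of the warping kernel
  have hastar' : ∀ n i, astar n i
      = ((γ i n)⁻¹ • (F i n (xt n i) - F i n (a n i)) - (C i (xt n i) - C i (a n i)))
        - ∑ j, (L j i).adjoint (vt n j - c n j) := by
    intro n i
    rw [hastar, ho, hl]
    simp only [map_sub, Finset.sum_sub_distrib, smul_sub, inv_smul_smul₀ (hγ0 i n)]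
    abel
  have hbstar' : ∀ n j, bstar n j
      = ((τ j n)⁻¹ • (W j n (yt n j) - W j n (b n j)) - (D j (yt n j) - D j (b n j)))
        + (vt n j - c n j) := by
    intro n j
    rw [hbstar, hf, ht]
    simp only [smul_sub, smul_add, inv_smul_smul₀ (hτ0 j n)]
    abel
  have hcstar' : ∀ n j, cstar n j
      = (vt n j - c n j) - (yt n j - b n j) + ∑ i, L j i (xt n i - a n i) := by
    intro n j
    rw [hcstar, hc]
    simp only [map_sub, Finset.sum_sub_distrib]
    abel
  obtain ⟨K, hK⟩ := saddleOperator_lipschitz hμ hClip hν hDlip L s r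
  obtain ⟨c₂, hc₂, hbound⟩ : ∃ K, 0 < K ∧ ∀ n, ‖ms n‖ ≤ K * ‖pt n - m n‖ := by
    refine TripleSum.exists_norm_le_mul (fun _ => norm_nonneg _) ?_ ?_ ?_
    · intro i
      obtain ⟨K, hK⟩ := exists_norm_sum_clm_le fun j => (L j i).adjoint
      refine ⟨((ε i)⁻¹ * χ i + μ i) + K, fun n => ?_⟩
      change ‖astar n i‖ ≤ _
      rw [hastar', add_mul]
      exact norm_sub_le_of_le (norm_forward_kernel_le (hχ i) (hμ i) (hε i).1 (hγ i n).1
        (hFlip i n _ _) (hClip i _ _) (TripleSum.norm_px_le (pt n - m n) i))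
        (hK _ _ (TripleSum.norm_pv_le (pt n - m n)))
    · intro j
      refine ⟨((δ j)⁻¹ * κ j + ν j) + 1, fun n => ?_⟩
      change ‖bstar n j‖ ≤ _
      rw [hbstar', add_mul, one_mul]
      exact norm_add_le_of_le (norm_forward_kernel_le (hκ j) (hν j) (hδ j).1 (hτ j n).1
        (hWlip j n _ _) (hDlip j _ _) (TripleSum.norm_py_le (pt n - m n) j))
        (TripleSum.norm_pv_le (pt n - m n) j)
    · intro j
      obtain ⟨K, hK⟩ := exists_norm_sum_clm_le fun i => L j i
      refine ⟨1 + 1 + K, fun n => ?_⟩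
      change ‖cstar n j‖ ≤ _
      rw [hcstar', add_mul, add_mul, one_mul]
      exact norm_add_le_of_le (norm_sub_le_of_le (TripleSum.norm_pv_le (pt n - m n) j)
        (TripleSum.norm_py_le (pt n - m n) j)) (hK _ _ (TripleSum.norm_px_le (pt n - m n)))
  obtain ⟨c₁, hc₁, hcoer⟩ :
      ∃ k, 0 < k ∧ ∀ n, k * ‖pt n - m n‖ ^ 2 ≤ ⟪pt n - m n, ms n⟫ := by
    obtain ⟨k, hk, hkle⟩ := exists_pos_le_of_finite
      (f := fun q : Option (I ⊕ J) => q.elim 1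
        (Sum.elim (fun i => ε i * μ i / α i) fun j => δ j * ν j / β j)) (by
        rintro (_ | i | j)
        · exact one_pos
        · exact div_pos (mul_pos (hε i).1 (hμ i)) (hα i)
        · exact div_pos (mul_pos (hδ j).1 (hν j)) (hβ j))
    refine ⟨k, hk, fun n => ?_⟩
    have hX : ∀ i, k * ‖xt n i - a n i‖ ^ 2 ≤ ⟪xt n i - a n i,
        (γ i n)⁻¹ • (F i n (xt n i) - F i n (a n i)) - (C i (xt n i) - C i (a n i))⟫ := fun i =>
      (mul_le_mul_of_nonneg_right (hkle (some (.inl i))) (sq_nonneg _)).trans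
        (forward_kernel_strongly_monotone (hα i) (hμ i) (hε i).1 (hγ i n) (hFsm i n _ _)
          (hClip i _ _))
    have hY : ∀ j, k * ‖yt n j - b n j‖ ^ 2 ≤ ⟪yt n j - b n j,
        (τ j n)⁻¹ • (W j n (yt n j) - W j n (b n j)) - (D j (yt n j) - D j (b n j))⟫ := fun j =>
      (mul_le_mul_of_nonneg_right (hkle (some (.inr j))) (sq_nonneg _)).trans
        (forward_kernel_strongly_monotone (hβ j) (hν j) (hδ j).1 (hτ j n) (hWsm j n _ _)
          (hDlip j _ _))
    have hV : ∀ j, k * ‖vt n j - c n j‖ ^ 2 ≤ ⟪vt n j - c n j, vt n j - c n j⟫ := fun j => by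
      rw [real_inner_self_eq_norm_sq]
      exact mul_le_of_le_one_left (sq_nonneg _) (hkle none)
    have hadj := sum_inner_sum_adjoint L (fun i => xt n i - a n i) fun j => vt n j - c n j
    have hcomm : ∑ j, ⟪yt n j - b n j, vt n j - c n j⟫ = ∑ j, ⟪vt n j - c n j, yt n j - b n j⟫ :=
      Finset.sum_congr rfl fun j _ => real_inner_comm _ _
    have h1 := Finset.sum_le_sum fun i (_ : i ∈ Finset.univ) => hX i
    have h2 := Finset.sum_le_sum fun j (_ : j ∈ Finset.univ) => hY j
    have h3 := Finset.sum_le_sum fun j (_ : j ∈ Finset.univ) => hV j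
    have e1 : ⟪pt n - m n, ms n⟫ = ∑ i, ⟪xt n i - a n i, astar n i⟫
        + ∑ j, (⟪yt n j - b n j, bstar n j⟫ + ⟪vt n j - c n j, cstar n j⟫) :=
      TripleSum.inner_eq _ _
    have e2 : ‖pt n - m n‖ ^ 2 = ∑ i, ‖xt n i - a n i‖ ^ 2
        + ∑ j, (‖yt n j - b n j‖ ^ 2 + ‖vt n j - c n j‖ ^ 2) := TripleSum.norm_sq_eq _
    rw [e1, e2]
    have f1 : ∑ i, ⟪xt n i - a n i, astar n i⟫ = ∑ i, ⟪xt n i - a n i,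
        (γ i n)⁻¹ • (F i n (xt n i) - F i n (a n i)) - (C i (xt n i) - C i (a n i))⟫
        - ∑ j, ⟪vt n j - c n j, ∑ i, L j i (xt n i - a n i)⟫ := by
      rw [← hadj, ← Finset.sum_sub_distrib]
      exact Finset.sum_congr rfl fun i _ => by rw [hastar', inner_sub_right]
    have f2 : ∑ j, ⟪yt n j - b n j, bstar n j⟫ = ∑ j, ⟪yt n j - b n j,
        (τ j n)⁻¹ • (W j n (yt n j) - W j n (b n j)) - (D j (yt n j) - D j (b n j))⟫
        + ∑ j, ⟪vt n j - c n j, yt n j - b n j⟫ := by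
      rw [← hcomm, ← Finset.sum_add_distrib]
      exact Finset.sum_congr rfl fun j _ => by rw [hbstar', inner_add_right]
    have f3 : ∑ j, ⟪vt n j - c n j, cstar n j⟫ = ∑ j, ⟪vt n j - c n j, vt n j - c n j⟫
        - ∑ j, ⟪vt n j - c n j, yt n j - b n j⟫
        + ∑ j, ⟪vt n j - c n j, ∑ i, L j i (xt n i - a n i)⟫ := by
      rw [← Finset.sum_sub_distrib, ← Finset.sum_add_distrib]
      exact Finset.sum_congr rfl fun j _ => by
        rw [hcstar', inner_add_right, inner_sub_right (vt n j - c n j) (vt n j - c n j)]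
    rw [Finset.sum_add_distrib, Finset.sum_add_distrib, f1, f2, f3]
    simp only [← Finset.mul_sum] at h1 h2 h3
    linarith
  have hmem : ∀ n, ms n - saddleOperator C D L s r (m n) ∈ productOperator A B (m n) := by
    intro n
    refine ⟨fun i => ?_, fun j => ?_, fun j => ?_⟩
    · change astar n i - (C i (a n i) + ∑ j, (L j i).adjoint (c n j) - s i) ∈ A i (a n i)
      convert ha n i using 1
      rw [hastar, ho]
      simp only [smul_sub, smul_add, inv_smul_smul₀ (hγ0 i n)]
      abel
    · change bstar n j - (D j (b n j) - c n j) ∈ B j (b n j)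
      convert hb n j using 1
      rw [hbstar, hf]
      abel
    · change cstar n j - (r j + b n j - ∑ i, L j i (a n i)) = 0
      rw [hcstar, sub_self]
  have hzer : ∃ z, -saddleOperator C D L s r z ∈ productOperator A B z := by
    obtain ⟨x₀, v₀, hx₀, hv₀⟩ := hKT
    exact ⟨.mk x₀ (fun j => ∑ k, L j k (x₀ k) - r j) v₀,
      neg_saddleOperator_mem_iff.2 ⟨hx₀, hv₀, fun _ => rfl⟩⟩
  have hθ' : ∀ n, ⟪m n - p n, ms n⟫ = θ n := fun n => by
    rw [hθ]
    exact TripleSum.inner_eq _ _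
  have hσ' : ∀ n, ‖ms n‖ ^ 2 = σ n := fun n => by
    rw [hσ]
    exact TripleSum.norm_sq_eq _
  have hrec : ∀ n, p (n + 1) = p n + ρ n • ms n := fun n => by
    simp only [hp, hms, TripleSum.mk_add_smul, ← hxrec, ← hyrec, ← hvrec]
  obtain ⟨z, hz, hweak⟩ := exists_weak_limit_of_projective_splitting
    (productOperator_monotone hAmono hBmono)
    (productOperator_maximal (fun i => mem_of_monotonically_related (hAmono i) (hAmax i))
      fun j => mem_of_monotonically_related (hBmono j) (hBmax j))
    (saddleOperator_monotone hCmono hDmono L s r) hK hzer hlo hlo' hhi hhi' hmem hc₁ hcoer hc₂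
    hbound (fun n => by rw [hθ', hσ']; exact hρ n) hrec
    (TripleSum.tendsto_zero (z := fun n => pt n - p n) hxt hyt hvt)
  obtain ⟨hzx, hzv, hzy⟩ := neg_saddleOperator_mem_iff.1 hz
  simp only [hzy] at hzv
  refine ⟨z.px, z.pv, fun i u => ?_, fun j u => ?_, ⟨hzx, hzv⟩, fun i => ?_, z.px, hzx, hzv⟩
  · simpa only [TripleSum.inner_mk_single_left, hp, TripleSum.px_mk] using hweak (.mk (Pi.single i u) 0 0)
  · simpa only [TripleSum.inner_mk_single_right, hp, TripleSum.pv_mk] using hweak (.mk 0 0 (Pi.single j u))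
  · obtain ⟨u, hu, he⟩ := hzx i
    refine ⟨u, hu, z.pv, hzv, ?_⟩
    rw [sub_eq_iff_eq_add] at he
    rw [he]
    abel
end
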